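/- (Diagonal main-term asymptotic.) Let h, ψ₁, ψ₂: (0,∞) → ℝ be smooth functions with compact support contained in (0,∞), with ψᵢ(y) = ψᵢ(1/y) for i = 1,2. Fix 3/4 < θ < 1, and for K ≥ 2 set G := K^θ and g(x) := h(x − K/G). Define D' := (√(2π) G²/16) · ∑_{n ≥ 1} ∑_{d₁ ≥ 1} ∑_{d₂ ≥ 1} ∑_{m ≥ 1} (1/(d₁ d₂ n²)) · ∫_0^∞ (g(√u)√u/√(2πu)) · ψ₁(√u·G/(4π n d₁)) · ψ₂(√u·G/(4π n d₂)) · exp(−√u·G·m²/(4n²)) du. Then for every ε > 0, as K → ∞: D' = K^{1/2} G log K · (√2·π/32) · ψ̃₁(0) ψ̃₂(0) · I_h + K^{1/2} G · I_h · ( (√2·π/16)·((3/2)γ − log(4π)) · ψ̃₁(0) ψ̃₂(0) + (√2·π/16) · ψ̃₁(0) ψ̃₂'(0) ) + K^{1/2} G · (√2·π/16) · I_h · (1/(2π)) ∫_{-∞}^{∞} ψ̃₁(−1−it) ψ̃₂(1+it) ζ(−it) ζ(2+it) dt + O( K^{2+ε} G^{-1} + K^{-1/2+ε} G² ), where I_h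 := ∫_0^∞ h(√u)/√(2πu) du, ψ̃ᵢ denotes the Mellin transform ψ̃ᵢ(s) := ∫_0^∞ ψᵢ(1/y) y^{s-1} dy, ψ̃₂' its derivative, γ is the Euler–Mascheroni constant, and ζ is the Riemann zeta function. -/

import Mathlib

open MeasureTheory Set

/-- The Mellin transform `ψ̃(s) = ∫_0^∞ ψ(1/y) y^{s-1} dy` of a real-valued `ψ`. -/
noncomputable def mellinT (ψ : ℝ → ℝ) (s : ℂ) : ℂ :=
  ∫ y in Ioi (0 : ℝ), (ψ (1 / y) : ℂ) * (y : ℂ) ^ (s - 1)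

/-- `I_h = ∫_0^∞ h(√u)/√(2πu) du`. -/
noncomputable def Ihint (h : ℝ → ℝ) : ℝ :=
  ∫ u in Ioi (0 : ℝ), h (Real.sqrt u) / Real.sqrt (2 * Real.pi * u)

/-- The diagonal sum `D'` (with `G = K^θ`, `g(x) = h(x - K/G)`), summed over
quadruples `(n, d₁, d₂, m)` of positive integers. -/
noncomputable def diagTerm (h ψ₁ ψ₂ : ℝ → ℝ) (θ K : ℝ) : ℝ :=
  Real.sqrt (2 * Real.pi) * (K ^ θ) ^ 2 / 16 *
    ∑' p : ℕ+ × ℕ+ × ℕ+ × ℕ+,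
      (1 / ((p.2.1 : ℝ) * (p.2.2.1 : ℝ) * (p.1 : ℝ) ^ 2)) *
        ∫ u in Ioi (0 : ℝ),
          h (Real.sqrt u - K / K ^ θ) * Real.sqrt u / Real.sqrt (2 * Real.pi * u) *
            ψ₁ (Real.sqrt u * K ^ θ / (4 * Real.pi * (p.1 : ℝ) * (p.2.1 : ℝ))) *
            ψ₂ (Real.sqrt u * K ^ θ / (4 * Real.pi * (p.1 : ℝ) * (p.2.2.1 : ℝ))) *
            Real.exp (-(Real.sqrt u * K ^ θ * (p.2.2.2 : ℝ) ^ 2 / (4 * (p.1 : ℝ) ^ 2)))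

/-- The main term in the diagonal asymptotic. -/
noncomputable def diagMain (h ψ₁ ψ₂ : ℝ → ℝ) (θ K : ℝ) : ℂ :=
  ((K ^ ((1 : ℝ) / 2) * K ^ θ * Real.log K * (Real.sqrt 2 * Real.pi / 32) * Ihint h : ℝ) : ℂ) *
      mellinT ψ₁ 0 * mellinT ψ₂ 0
  + ((K ^ ((1 : ℝ) / 2) * K ^ θ * Ihint h : ℝ) : ℂ) *
      (((Real.sqrt 2 * Real.pi / 16 *
          ((3 : ℝ) / 2 * Real.eulerMascheroniConstant - Real.log (4 * Real.pi)) : ℝ) : ℂ) *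
          mellinT ψ₁ 0 * mellinT ψ₂ 0
        + ((Real.sqrt 2 * Real.pi / 16 : ℝ) : ℂ) * mellinT ψ₁ 0 * deriv (mellinT ψ₂) 0)
  + ((K ^ ((1 : ℝ) / 2) * K ^ θ * (Real.sqrt 2 * Real.pi / 16) * Ihint h *
        (1 / (2 * Real.pi)) : ℝ) : ℂ) *
      ∫ t : ℝ, mellinT ψ₁ (-1 - t * Complex.I) * mellinT ψ₂ (1 + t * Complex.I) *
        riemannZeta (-(t * Complex.I)) * riemannZeta (2 + t * Complex.I)

section
open Filter Topology

/-- A smooth weight with compact support in `(0, ∞)`, invariant under `y ↦ 1 / y`. -/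
structure IsCutoff (ψ : ℝ → ℝ) : Prop where
  smooth : ContDiff ℝ (⊤ : ℕ∞) ψ
  compact : HasCompactSupport ψ
  pos : tsupport ψ ⊆ Ioi 0
  symm : ∀ y : ℝ, 0 < y → ψ y = ψ (1 / y)

lemma exists_support_bounds {ψ : ℝ → ℝ} (hc : HasCompactSupport ψ) (hp : tsupport ψ ⊆ Ioi 0) :
    ∃ a b, 0 < a ∧ a < b ∧ ∀ y, ψ y ≠ 0 → a < y ∧ y < b := by
  rcases (tsupport ψ).eq_empty_or_nonempty with he | hne
  · refine ⟨1, 2, one_pos, one_lt_two, fun y hy => ?_⟩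
    have := subset_tsupport ψ (Function.mem_support.2 hy)
    simp [he] at this
  · obtain ⟨x, hx, hmin⟩ := hc.isCompact.exists_isMinOn hne continuousOn_id
    obtain ⟨z, hz, hmax⟩ := hc.isCompact.exists_isMaxOn hne continuousOn_id
    have hx0 : 0 < x := hp hx
    have hxz : x ≤ z := by simpa using isMinOn_iff.1 hmin z hz
    refine ⟨x / 2, z + 1, by positivity, by linarith, fun y hy => ?_⟩
    have hy' := subset_tsupport ψ (Function.mem_support.2 hy)
    have h1 : x ≤ y := by simpa using isMinOn_iff.1 hmin y hy'
    have h2 : y ≤ z := by simpa using isMaxOn_iff.1 hmax y hy'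
    constructor <;> linarith

lemma exists_abs_bound {ψ : ℝ → ℝ} (hψ : Continuous ψ) (hc : HasCompactSupport ψ) :
    ∃ M, 0 ≤ M ∧ ∀ y, |ψ y| ≤ M := by
  obtain ⟨M, hM⟩ := hc.exists_bound_of_continuous hψ
  exact ⟨M, (norm_nonneg _).trans (hM 0), hM⟩

/-- The sum `∑_{d ≥ 1} ψ(Y / d) / d`; the term `d = 0` vanishes by convention. -/
noncomputable def dilSum (ψ : ℝ → ℝ) (Y : ℝ) : ℝ := ∑' d : ℕ, ψ (Y / d) / d

lemma dilSum_eq_sum {ψ : ℝ → ℝ} {a : ℝ} (ha : 0 < a) (hψ : ∀ y, ψ y ≠ 0 → a < y)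
    {Y : ℝ} {N : ℕ} (hN : Y ≤ a * N) :
    dilSum ψ Y = ∑ d ∈ Finset.range N, ψ (Y / d) / d := by
  refine tsum_eq_sum fun d hd => ?_
  have hd' : N ≤ d := by simpa using hd
  rcases Nat.eq_zero_or_pos d with rfl | hd0
  · simp
  have hd1 : (0 : ℝ) < d := by exact_mod_cast hd0
  have hd2 : (N : ℝ) ≤ d := by exact_mod_cast hd'
  by_contra hne
  have h1 : ψ (Y / d) ≠ 0 := fun h => hne (by simp [h])
  have h2 := hψ _ h1
  rw [lt_div_iff₀ hd1] at h2
  nlinarith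

lemma dilSum_eq_zero {ψ : ℝ → ℝ} {a : ℝ} (ha : 0 < a) (hψ : ∀ y, ψ y ≠ 0 → a < y)
    {Y : ℝ} (hY : Y ≤ a) : dilSum ψ Y = 0 := by
  rw [dilSum_eq_sum (N := 1) ha hψ (by simpa using hY)]
  simp

lemma exists_dilSum_bound {ψ : ℝ → ℝ} (hψ : Continuous ψ) (hc : HasCompactSupport ψ)
    (hp : tsupport ψ ⊆ Ioi 0) : ∃ C, 0 ≤ C ∧ ∀ Y, |dilSum ψ Y| ≤ C := by
  obtain ⟨a, b, ha, hab, hs⟩ := exists_support_bounds hc hp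
  obtain ⟨M, hM, hMψ⟩ := exists_abs_bound hψ hc
  have hb : 0 < b := ha.trans hab
  refine ⟨(1 / a + 1) * (M * b) + M * b / a, by positivity, fun Y => ?_⟩
  rcases le_or_gt Y a with hY | hY
  · rw [dilSum_eq_zero ha (fun y hy => (hs y hy).1) hY, abs_zero]; positivity
  have hY0 : 0 < Y := ha.trans hY
  have hN : Y ≤ a * (⌈Y / a⌉₊ : ℝ) := by
    have := Nat.le_ceil (Y / a)
    rw [div_le_iff₀ ha] at this; linarith
  rw [dilSum_eq_sum ha (fun y hy => (hs y hy).1) hN]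
  have hterm : ∀ d ∈ Finset.range ⌈Y / a⌉₊, |ψ (Y / d) / d| ≤ M * b / Y := by
    intro d _
    rcases Nat.eq_zero_or_pos d with rfl | hd0
    · simp; positivity
    have hd1 : (0 : ℝ) < d := by exact_mod_cast hd0
    by_cases h0 : ψ (Y / d) = 0
    · simp [h0]; positivity
    have h2 := (hs _ h0).2
    rw [div_lt_iff₀ hd1] at h2
    rw [abs_div, abs_of_pos hd1, div_le_div_iff₀ hd1 hY0]
    have := hMψ (Y / d)
    nlinarith [abs_nonneg (ψ (Y / d))]
  refine (Finset.abs_sum_le_sum_abs _ _).trans ((Finset.sum_le_sum hterm).trans ?_)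
  rw [Finset.sum_const, Finset.card_range, nsmul_eq_mul]
  have hc' : (⌈Y / a⌉₊ : ℝ) ≤ Y / a + 1 := (Nat.ceil_lt_add_one (by positivity)).le
  calc (⌈Y / a⌉₊ : ℝ) * (M * b / Y) ≤ (Y / a + 1) * (M * b / Y) := by gcongr
    _ = M * b / a + M * b / Y := by field_simp
    _ ≤ M * b / a + M * b / a := by gcongr
    _ ≤ _ := by
      have : M * b / a = 1 / a * (M * b) := by ring
      have h3 : 0 ≤ M * b := by positivity
      nlinarith

lemma hasDerivAt_dilSum {ψ : ℝ → ℝ} (hψ : ContDiff ℝ 1 ψ) (hc : HasCompactSupport ψ)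
    (hp : tsupport ψ ⊆ Ioi 0) {Y : ℝ} (hY : 0 < Y) :
    HasDerivAt (dilSum ψ) (dilSum (fun y => y * deriv ψ y) Y / Y) Y := by
  obtain ⟨a, b, ha, hab, hs⟩ := exists_support_bounds hc hp
  have hs' : ∀ y, y * deriv ψ y ≠ 0 → a / 2 < y := by
    intro y hy
    by_contra hlt
    apply hy
    have : ψ =ᶠ[𝓝 y] fun _ => 0 := by
      filter_upwards [Iio_mem_nhds (show y < a by linarith)] with z hz
      by_contra h0
      exact absurd (hs z h0).1 (not_lt.2 (le_of_lt hz))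
    rw [this.deriv_eq]; simp
  set N := ⌈(Y + 1) / (a / 2)⌉₊
  have hN : Y + 1 ≤ a / 2 * (N : ℝ) := by
    have := Nat.le_ceil ((Y + 1) / (a / 2))
    rw [div_le_iff₀ (by positivity)] at this; rw [mul_comm]; exact this
  have hN2 : (0 : ℝ) ≤ N := Nat.cast_nonneg _
  have heq : dilSum ψ =ᶠ[𝓝 Y] fun y => ∑ d ∈ Finset.range N, ψ (y / d) / d := by
    filter_upwards [Iio_mem_nhds (show Y < Y + 1 by linarith)] with z hz
    exact dilSum_eq_sum ha (fun y hy => (hs y hy).1) (by nlinarith [mem_Iio.1 hz])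
  refine HasDerivAt.congr_of_eventuallyEq ?_ heq
  rw [dilSum_eq_sum (by positivity) hs' (show Y ≤ a / 2 * N by linarith), Finset.sum_div]
  refine HasDerivAt.fun_sum fun d _ => ?_
  rcases Nat.eq_zero_or_pos d with rfl | hd0
  · simpa using hasDerivAt_const Y (0 : ℝ)
  have hd1 : (d : ℝ) ≠ 0 := by exact_mod_cast hd0.ne'
  have h1 : HasDerivAt ψ (deriv ψ (Y / d)) (Y / d) :=
    (hψ.differentiable one_ne_zero _).hasDerivAt
  have h2 : HasDerivAt (fun y : ℝ => y / (d : ℝ)) (1 / d) Y := (hasDerivAt_id Y).div_const _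
  refine ((h1.comp Y h2).div_const (d : ℝ)).congr_deriv ?_
  field_simp

lemma IsCutoff.contDiff_mul_deriv {ψ : ℝ → ℝ} (h : IsCutoff ψ) :
    Continuous (fun y => y * deriv ψ y) :=
  continuous_id.mul (h.smooth.continuous_deriv (by simp))

lemma IsCutoff.exists_dilSum_mul_deriv_bound {ψ : ℝ → ℝ} (h : IsCutoff ψ) :
    ∃ C, 0 ≤ C ∧ ∀ Y, |dilSum (fun y => y * deriv ψ y) Y| ≤ C := by
  refine exists_dilSum_bound h.contDiff_mul_deriv h.compact.deriv.mul_left ?_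
  refine (closure_mono ?_).trans (subset_closure.trans ?_ : tsupport (deriv ψ) ⊆ Ioi 0)
  · exact Function.support_mul_subset_right _ _
  · rw [IsClosed.closure_eq (isClosed_tsupport _)]
    exact tsupport_deriv_subset.trans h.pos

/-- `ψ(v) / v` as a complex-valued Schwartz function. -/
lemma IsCutoff.exists_schwartz {ψ : ℝ → ℝ} (h : IsCutoff ψ) :
    ∃ κ : SchwartzMap ℝ ℂ, ∀ v, κ v = ((ψ v / v : ℝ) : ℂ) := by
  obtain ⟨a, b, ha, hab, hs⟩ := exists_support_bounds h.compact h.pos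
  have hsm : ContDiff ℝ (⊤ : ℕ∞) (fun v : ℝ => ψ v / v) := by
    rw [contDiff_iff_contDiffAt]
    intro v
    rcases lt_or_ge v a with hv | hv
    · have : (fun v : ℝ => ψ v / v) =ᶠ[𝓝 v] fun _ => 0 := by
        filter_upwards [Iio_mem_nhds hv] with z hz
        have : ψ z = 0 := by
          by_contra h0
          exact absurd (hs z h0).1 (not_lt.2 (le_of_lt hz))
        simp [this]
      exact contDiffAt_const.congr_of_eventuallyEq this
    · exact h.smooth.contDiffAt.div contDiffAt_id (by linarith)
  have hcs : HasCompactSupport (fun v : ℝ => ((ψ v / v : ℝ) : ℂ)) := by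
    refine h.compact.mono fun v hv => ?_
    simp only [Function.mem_support] at hv ⊢
    intro h0; apply hv; simp [h0]
  exact ⟨hcs.toSchwartzMap (Complex.ofRealCLM.contDiff.comp hsm), fun v => rfl⟩

end

section
open Filter Topology FourierTransform

/-- The logarithmic mass `∫_0^∞ ψ(v) dv / v`. -/
noncomputable def logMass (ψ : ℝ → ℝ) : ℝ := ∫ v in Ioi (0 : ℝ), ψ v / v

lemma IsCutoff.eq_zero_of_nonpos {ψ : ℝ → ℝ} (h : IsCutoff ψ) {y : ℝ} (hy : y ≤ 0) : ψ y = 0 := by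
  obtain ⟨a, b, ha, -, hs⟩ := exists_support_bounds h.compact h.pos
  by_contra h0
  linarith [(hs y h0).1]

lemma IsCutoff.dilSum_eq_tsum_int {ψ : ℝ → ℝ} (h : IsCutoff ψ) {κ : SchwartzMap ℝ ℂ}
    (hκ : ∀ v, κ v = ((ψ v / v : ℝ) : ℂ)) {Y : ℝ} (hY : 0 < Y) :
    ((dilSum ψ Y : ℝ) : ℂ) = (1 / Y : ℂ) * ∑' n : ℤ, κ (Y⁻¹ * n) := by
  have hinj : Function.Injective (fun n : ℕ => (n : ℤ)) := Nat.cast_injective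
  have hsupp : Function.support (fun n : ℤ => κ (Y⁻¹ * n)) ⊆ Set.range (fun n : ℕ => (n : ℤ)) := by
    intro n hn
    rcases le_or_gt 0 n with h0 | h0
    · exact ⟨n.toNat, by simpa using h0⟩
    · exfalso
      apply hn
      have h1 : (n : ℝ) < 0 := by exact_mod_cast h0
      have h2 : Y⁻¹ * (n : ℝ) ≤ 0 := mul_nonpos_of_nonneg_of_nonpos (by positivity) h1.le
      simp [hκ, h.eq_zero_of_nonpos h2]
  rw [← hinj.tsum_eq hsupp, ← tsum_mul_left, dilSum, Complex.ofReal_tsum]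
  congr 1
  ext d
  rcases Nat.eq_zero_or_pos d with rfl | hd
  · simp [hκ]
  have hd1 : (0 : ℝ) < d := by exact_mod_cast hd
  rw [hκ, h.symm (Y / d) (by positivity)]
  rw [show 1 / (Y / (d : ℝ)) = Y⁻¹ * (((d : ℤ) : ℝ)) by push_cast; field_simp]
  push_cast
  have h2 : (d : ℂ) ≠ 0 := by exact_mod_cast hd.ne'
  have h3 : (Y : ℂ) ≠ 0 := by exact_mod_cast hY.ne'
  field_simp

lemma tsum_int_scale_eq (κ : SchwartzMap ℝ ℂ) {Y : ℝ} (hY : 0 < Y) :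
    (1 / Y : ℂ) * ∑' n : ℤ, κ (Y⁻¹ * n) = ∑' n : ℤ, 𝓕 (κ : ℝ → ℂ) (Y * n) := by
  have hY' : Y⁻¹ ≠ 0 := inv_ne_zero hY.ne'
  let e : ℝ ≃L[ℝ] ℝ := ContinuousLinearEquiv.unitsEquivAut ℝ (Units.mk0 Y⁻¹ hY')
  let g : SchwartzMap ℝ ℂ := SchwartzMap.compCLMOfContinuousLinearEquiv ℂ e κ
  have hg : ∀ v, g v = κ (Y⁻¹ * v) := fun v => by
    simp [g, e, mul_comm]
  have hF : ∀ w, 𝓕 (g : ℝ → ℂ) w = Y * 𝓕 (κ : ℝ → ℂ) (Y * w) := by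
    intro w
    rw [Real.fourier_real_eq, Real.fourier_real_eq]
    have := Measure.integral_comp_mul_left (fun v : ℝ => Real.fourierChar (-(v * (Y * w))) • κ v) Y⁻¹
    rw [inv_inv, abs_of_pos hY, Complex.real_smul] at this
    rw [← this]
    congr 1
    ext v
    rw [hg, show Y⁻¹ * v * (Y * w) = v * w by field_simp]
  have hP := g.tsum_eq_tsum_fourier 0
  simp only [zero_add, QuotientAddGroup.mk_zero, fourier_eval_zero, mul_one, hg] at hP
  rw [hP]
  have h3 : (Y : ℂ) ≠ 0 := by exact_mod_cast hY.ne'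
  rw [← tsum_mul_left]
  congr 1
  ext n
  have := hF n
  simp only [SchwartzMap.fourier_coe] at this ⊢
  rw [this]
  field_simp

lemma IsCutoff.exists_dilSum_sub_bound {ψ : ℝ → ℝ} (h : IsCutoff ψ) {k : ℕ} (hk : 2 ≤ k) :
    ∃ C, 0 ≤ C ∧ ∀ Y, 0 < Y → |dilSum ψ Y - logMass ψ| ≤ C / Y ^ k := by
  obtain ⟨κ, hκ⟩ := h.exists_schwartz
  obtain ⟨C, hC, hdec⟩ := (𝓕 κ).decay k 0
  simp only [norm_iteratedFDeriv_zero, SchwartzMap.fourier_coe] at hdec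
  have hsum : Summable fun n : ℤ => (|(n : ℝ)| ^ (-(k : ℝ))) :=
    Real.summable_abs_int_rpow (by exact_mod_cast hk)
  refine ⟨C * ∑' n : ℤ, |(n : ℝ)| ^ (-(k : ℝ)), by positivity, fun Y hY => ?_⟩
  have hterm : ∀ n : ℤ, n ≠ 0 → ‖𝓕 (κ : ℝ → ℂ) (Y * n)‖ ≤ C / Y ^ k * |(n : ℝ)| ^ (-(k : ℝ)) := by
    intro n hn
    have hn' : 0 < |(n : ℝ)| := abs_pos.2 (by exact_mod_cast hn)
    have h1 := hdec (Y * n)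
    rw [Real.norm_eq_abs, abs_mul, abs_of_pos hY, mul_pow] at h1
    rw [Real.rpow_neg hn'.le, Real.rpow_natCast, ← div_eq_mul_inv, div_div,
      le_div_iff₀ (by positivity)]
    linarith
  have hbd : ∀ n : ℤ, ‖if n = 0 then 0 else 𝓕 (κ : ℝ → ℂ) (Y * n)‖
      ≤ C / Y ^ k * |(n : ℝ)| ^ (-(k : ℝ)) := by
    intro n
    split_ifs with hn
    · simp only [norm_zero]; positivity
    · exact hterm n hn
  have hs2 : Summable fun n : ℤ => if n = 0 then 0 else 𝓕 (κ : ℝ → ℂ) (Y * n) :=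
    Summable.of_norm_bounded (hsum.mul_left _) hbd
  have hs3 : Summable fun n : ℤ => 𝓕 (κ : ℝ → ℂ) (Y * n) := by
    refine (hs2.congr_cofinite ?_)
    filter_upwards [(Set.finite_singleton (0 : ℤ)).compl_mem_cofinite] with n hn
    simp at hn; simp [hn]
  have hzero : 𝓕 (κ : ℝ → ℂ) (Y * ((0 : ℤ) : ℝ)) = (logMass ψ : ℂ) := by
    rw [Real.fourier_real_eq, logMass, ← integral_complex_ofReal,
      ← integral_indicator measurableSet_Ioi]
    congr 1
    ext v
    by_cases hv : v ∈ Ioi (0 : ℝ)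
    · simp [hκ, hv]
    · rw [indicator_of_notMem hv]
      simp [hκ, h.eq_zero_of_nonpos (not_lt.1 hv)]
  have hmain : ((dilSum ψ Y - logMass ψ : ℝ) : ℂ)
      = ∑' n : ℤ, if n = 0 then 0 else 𝓕 (κ : ℝ → ℂ) (Y * n) := by
    push_cast
    rw [h.dilSum_eq_tsum_int hκ hY, tsum_int_scale_eq κ hY, hs3.tsum_eq_add_tsum_ite 0, hzero]
    ring
  rw [← Real.norm_eq_abs, ← Complex.norm_real, hmain]
  refine (tsum_of_norm_bounded (hsum.mul_left (C / Y ^ k)).hasSum hbd).trans (le_of_eq ?_)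
  rw [tsum_mul_left]
  ring

end

section
open Filter Topology Asymptotics

lemma isBigO_atTop_of_eventually_zero {f : ℝ → ℂ} {b : ℝ} (hf : ∀ y, b ≤ y → f y = 0) (r : ℝ) :
    f =O[atTop] (· ^ (-r) : ℝ → ℝ) :=
  ((isBigO_zero _ _).congr' (by
    filter_upwards [eventually_ge_atTop b] with y hy using (hf y hy).symm) .rfl)

lemma isBigO_zero_of_eventually_zero {f : ℝ → ℂ} {a : ℝ} (ha : 0 < a)
    (hf : ∀ y, 0 < y → y < a → f y = 0) (r : ℝ) :
    f =O[𝓝[>] 0] (· ^ (-r) : ℝ → ℝ) :=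
  ((isBigO_zero _ _).congr' (by
    filter_upwards [Ioo_mem_nhdsGT ha] with y hy using (hf y hy.1 hy.2).symm) .rfl)

variable {ψ : ℝ → ℝ}

lemma IsCutoff.continuous (h : IsCutoff ψ) : Continuous ψ := h.smooth.continuous

lemma IsCutoff.mellin_aux (h : IsCutoff ψ) (z : ℂ) :
    MellinConvergent (fun y => (ψ y : ℂ)) z ∧
      DifferentiableAt ℂ (mellin (fun y => (ψ y : ℂ))) z := by
  obtain ⟨a, b, ha, hab, hs⟩ := exists_support_bounds h.compact h.pos
  have hloc : LocallyIntegrableOn (fun y => (ψ y : ℂ)) (Ioi 0) :=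
    (Complex.continuous_ofReal.comp h.continuous).continuousOn.locallyIntegrableOn
      measurableSet_Ioi
  have htop := isBigO_atTop_of_eventually_zero (f := fun y => (ψ y : ℂ)) (b := b) (fun y hy => by
    by_contra h0
    exact absurd (hs y (by simpa using h0)).2 (not_lt.2 hy)) (z.re + 1)
  have hbot := isBigO_zero_of_eventually_zero (f := fun y => (ψ y : ℂ)) ha (fun y _ hy => by
    by_contra h0
    exact absurd (hs y (by simpa using h0)).1 (not_lt.2 hy.le)) (z.re - 1)
  exact ⟨mellinConvergent_of_isBigO_rpow hloc htop (by linarith) hbot (by linarith),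
    mellin_differentiableAt_of_isBigO_rpow hloc htop (by linarith) hbot (by linarith)⟩

lemma mellinT_eq_mellin_neg (ψ : ℝ → ℝ) (s : ℂ) :
    mellinT ψ s = mellin (fun y => (ψ y : ℂ)) (-s) := by
  rw [← mellin_comp_inv, mellin, mellinT]
  simp [mul_comm, one_div]

lemma IsCutoff.mellinT_eq_mellin (h : IsCutoff ψ) (s : ℂ) :
    mellinT ψ s = mellin (fun y => (ψ y : ℂ)) s := by
  rw [mellin, mellinT]
  refine setIntegral_congr_fun measurableSet_Ioi fun y hy => ?_
  simp only [smul_eq_mul]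
  rw [← h.symm y hy, mul_comm]

lemma IsCutoff.mellinT_neg (h : IsCutoff ψ) (s : ℂ) : mellinT ψ (-s) = mellinT ψ s := by
  rw [h.mellinT_eq_mellin s, mellinT_eq_mellin_neg, neg_neg]

lemma IsCutoff.differentiable_mellinT (h : IsCutoff ψ) : Differentiable ℂ (mellinT ψ) := by
  rw [show mellinT ψ = mellin (fun y => (ψ y : ℂ)) from funext h.mellinT_eq_mellin]
  exact fun z => (h.mellin_aux z).2

lemma IsCutoff.mellinT_zero (h : IsCutoff ψ) : mellinT ψ 0 = (logMass ψ : ℂ) := by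
  rw [h.mellinT_eq_mellin, mellin, logMass, ← integral_complex_ofReal]
  refine setIntegral_congr_fun measurableSet_Ioi fun y hy => ?_
  simp [Complex.cpow_neg_one]
  ring

lemma IsCutoff.continuousOn_dilSum (h : IsCutoff ψ) : ContinuousOn (dilSum ψ) (Ioi 0) :=
  fun _ hY => (hasDerivAt_dilSum (h.smooth.of_le (by simp)) h.compact h.pos
    hY).continuousAt.continuousWithinAt

lemma IsCutoff.hasMellin_dilSum (h : IsCutoff ψ) {z : ℂ} (hz : z.re < 0) :
    HasMellin (fun Y => (dilSum ψ Y : ℂ)) z (riemannZeta (1 - z) * mellinT ψ z) := by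
  have hz1 : 1 - z ≠ 0 := fun h0 => by
    have := congrArg Complex.re h0; simp at this; linarith
  obtain ⟨a, b, ha, hab, hs⟩ := exists_support_bounds h.compact h.pos
  constructor
  · obtain ⟨C, hC, hb⟩ := exists_dilSum_bound h.continuous h.compact h.pos
    refine mellinConvergent_of_isBigO_rpow (a := 0) (b := z.re - 1) ?_ ?_ hz ?_ (by linarith)
    · exact (Complex.continuous_ofReal.comp_continuousOn
        h.continuousOn_dilSum).locallyIntegrableOn measurableSet_Ioi
    · refine IsBigO.of_bound C (Eventually.of_forall fun Y => ?_)
      simpa using hb Y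
    · refine isBigO_zero_of_eventually_zero ha (fun y _ hy => ?_) _
      rw [dilSum_eq_zero ha (fun y hy => (hs y hy).1) hy.le, Complex.ofReal_zero]
  set T : ℕ → ℝ → ℂ := fun d Y => (Y : ℂ) ^ (z - 1) * ((ψ (Y / d) / d : ℝ) : ℂ) with hT
  have hTint : ∀ d, Integrable (T d) (volume.restrict (Ioi 0)) := by
    intro d
    rcases Nat.eq_zero_or_pos d with rfl | hd
    · simp [hT]
    have hd1 : (0 : ℝ) < (d : ℝ)⁻¹ := by positivity
    have := ((MellinConvergent.comp_mul_left (f := fun y => (ψ y : ℂ)) (s := z) hd1).2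
      (h.mellin_aux z).1).div_const (d : ℂ)
    refine this.congr (ae_of_all _ fun Y => ?_)
    simp only [hT, smul_eq_mul]
    push_cast
    rw [inv_mul_eq_div]
  have hTval : ∀ d, ∫ Y in Ioi 0, T d Y = 1 / (d : ℂ) ^ (1 - z) * mellinT ψ z := by
    intro d
    rcases Nat.eq_zero_or_pos d with rfl | hd
    · simp [hT, hz1]
    have hd1 : (0 : ℝ) < (d : ℝ)⁻¹ := by positivity
    have hd2 : (d : ℂ) ≠ 0 := by exact_mod_cast hd.ne'
    have h1 := mellin_comp_mul_left (fun y => (ψ y : ℂ)) z hd1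
    rw [h.mellinT_eq_mellin, Complex.cpow_sub _ _ hd2, Complex.cpow_one]
    have h2 : ∫ Y in Ioi 0, T d Y = mellin (fun y => (ψ ((d : ℝ)⁻¹ * y) : ℂ) / d) z := by
      rw [mellin]
      refine integral_congr_ae (ae_of_all _ fun Y => ?_)
      simp only [hT, smul_eq_mul]
      push_cast
      rw [inv_mul_eq_div]
    rw [h2, mellin_div_const, h1, smul_eq_mul, Complex.ofReal_inv, Complex.ofReal_natCast,
      Complex.inv_cpow _ _ (by rw [Complex.natCast_arg]; exact Real.pi_pos.ne), Complex.cpow_neg]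
    have : (d : ℂ) ^ z ≠ 0 := by simp [Complex.cpow_eq_zero_iff, hd2]
    field_simp
  have hTnorm : ∀ d : ℕ, ∫ Y in Ioi 0, ‖T d Y‖ =
      (d : ℝ) ^ (z.re - 1) * ∫ Y in Ioi (0 : ℝ), Y ^ (z.re - 1) * |ψ Y| := by
    intro d
    rcases Nat.eq_zero_or_pos d with rfl | hd
    · rw [Nat.cast_zero, Real.zero_rpow (by linarith)]
      simp [hT]
    have hd0 : (0 : ℝ) < d := by exact_mod_cast hd
    have hd1 : (0 : ℝ) < (d : ℝ)⁻¹ := by positivity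
    have h1 := integral_comp_mul_left_Ioi (fun Y : ℝ => Y ^ (z.re - 1) * |ψ Y|) 0 hd1
    rw [mul_zero, inv_inv, smul_eq_mul] at h1
    have h2 : ∫ Y in Ioi 0, ‖T d Y‖ = ∫ Y in Ioi (0 : ℝ), (d : ℝ) ^ (z.re - 1) * (d : ℝ)⁻¹ *
        (((d : ℝ)⁻¹ * Y) ^ (z.re - 1) * |ψ ((d : ℝ)⁻¹ * Y)|) := by
      refine setIntegral_congr_fun measurableSet_Ioi fun Y hY => ?_
      have hY' : (0 : ℝ) < Y := hY
      simp only [hT, norm_mul, Complex.norm_cpow_eq_rpow_re_of_pos hY', Complex.norm_real,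
        norm_div, Real.norm_eq_abs, abs_of_pos hd0, Complex.sub_re, Complex.one_re]
      rw [Real.mul_rpow hd1.le hY'.le, Real.inv_rpow hd0.le, inv_mul_eq_div]
      have : (d : ℝ) ^ (z.re - 1) ≠ 0 := (Real.rpow_pos_of_pos hd0 _).ne'
      field_simp
    rw [h2, integral_const_mul, h1]
    field_simp
  have hsum : Summable fun d => ∫ Y in Ioi 0, ‖T d Y‖ := by
    simp_rw [hTnorm]
    exact (Real.summable_nat_rpow.2 (by linarith)).mul_right _
  have key := hasSum_integral_of_summable_integral_norm hTint hsum
  simp_rw [hTval] at key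
  have hζ := (Complex.summable_one_div_nat_cpow (p := 1 - z)).2 (by simp; linarith)
  have key2 := hζ.hasSum.mul_right (mellinT ψ z)
  rw [← zeta_eq_tsum_one_div_nat_cpow (by simp; linarith)] at key2
  rw [← key.unique key2, mellin]
  refine setIntegral_congr_fun measurableSet_Ioi fun Y hY => ?_
  simp only [hT, tsum_mul_left, smul_eq_mul, dilSum, Complex.ofReal_tsum]

/-- `dilSum ψ` with its limit at infinity removed on `(1, ∞)`. -/
noncomputable def regSum (ψ : ℝ → ℝ) (Y : ℝ) : ℂ :=
  ((dilSum ψ Y - logMass ψ : ℝ) : ℂ) + (logMass ψ : ℂ) * indicator (Ioc 0 1) (fun _ => 1) Y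

lemma IsCutoff.isBigO_dilSum_sub (h : IsCutoff ψ) (r : ℝ) :
    (fun Y => ((dilSum ψ Y - logMass ψ : ℝ) : ℂ)) =O[atTop] (· ^ (-r) : ℝ → ℝ) := by
  obtain ⟨k, hk⟩ := exists_nat_gt (max r 2)
  obtain ⟨C, hC, hb⟩ := h.exists_dilSum_sub_bound (k := k)
    (by exact_mod_cast ((le_max_right r 2).trans hk.le))
  refine IsBigO.of_bound C ?_
  filter_upwards [eventually_ge_atTop 1] with Y hY
  have hY0 : 0 < Y := by linarith
  rw [Complex.norm_real, Real.norm_eq_abs, Real.norm_eq_abs, abs_of_pos (Real.rpow_pos_of_pos hY0 _)]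
  refine (hb Y hY0).trans ?_
  rw [div_eq_mul_inv, ← Real.rpow_natCast, ← Real.rpow_neg hY0.le]
  gcongr
  exact (le_max_left r 2).trans hk.le

lemma locallyIntegrableOn_indicator_one :
    LocallyIntegrableOn (indicator (Ioc 0 1) (fun _ => 1 : ℝ → ℂ)) (Ioi 0) :=
  ((integrable_indicator_iff measurableSet_Ioc).2
    (integrableOn_const (by simp))).integrableOn.locallyIntegrableOn

lemma IsCutoff.locallyIntegrableOn_dilSum_sub (h : IsCutoff ψ) :
    LocallyIntegrableOn (fun Y => ((dilSum ψ Y - logMass ψ : ℝ) : ℂ)) (Ioi 0) :=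
  (Complex.continuous_ofReal.comp_continuousOn
        (h.continuousOn_dilSum.sub continuousOn_const)).locallyIntegrableOn measurableSet_Ioi

lemma IsCutoff.regSum_aux (h : IsCutoff ψ) (z : ℂ) :
    MellinConvergent (regSum ψ) z ∧ DifferentiableAt ℂ (mellin (regSum ψ)) z := by
  obtain ⟨a, b, ha, hab, hs⟩ := exists_support_bounds h.compact h.pos
  have hloc : LocallyIntegrableOn (regSum ψ) (Ioi 0) := by
    refine h.locallyIntegrableOn_dilSum_sub.add ?_
    have := locallyIntegrableOn_indicator_one.smul (logMass ψ : ℂ)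
    exact this
  have htop : regSum ψ =O[atTop] (· ^ (-(z.re + 1)) : ℝ → ℝ) := by
    refine (h.isBigO_dilSum_sub _).congr' ?_ .rfl
    filter_upwards [eventually_gt_atTop 1] with Y hY
    simp [regSum, hY]
  have hbot := isBigO_zero_of_eventually_zero (f := regSum ψ) (a := min a 1)
    (lt_min ha one_pos) (fun y hy0 hy => by
      have h1 : dilSum ψ y = 0 := dilSum_eq_zero ha (fun y hy => (hs y hy).1)
        (hy.le.trans (min_le_left _ _))
      have h2 : y ≤ 1 := hy.le.trans (min_le_right _ _)
      simp [regSum, h1, hy0, h2]) (z.re - 1)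
  exact ⟨mellinConvergent_of_isBigO_rpow hloc htop (by linarith) hbot (by linarith),
    mellin_differentiableAt_of_isBigO_rpow hloc htop (by linarith) hbot (by linarith)⟩

lemma hasMellin_indicator_Ioi {z : ℂ} (hz : z.re < 0) :
    HasMellin (indicator (Ioi 1) (fun _ => 1 : ℝ → ℂ)) z (-(1 / z)) := by
  have h1 : (z - 1).re < -1 := by simp; linarith
  have h2 := integrableOn_Ioi_cpow_of_lt h1 one_pos
  have h3 := integral_Ioi_cpow_of_lt h1 one_pos
  have he : ∀ t : ℝ, (t : ℂ) ^ (z - 1) • indicator (Ioi 1) (fun _ => 1 : ℝ → ℂ) t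
      = indicator (Ioi 1) (fun t : ℝ => (t : ℂ) ^ (z - 1)) t := fun t => by
    by_cases ht : t ∈ Ioi (1 : ℝ) <;> simp [indicator, ht]
  constructor
  · rw [MellinConvergent]
    simp_rw [he]
    exact ((integrable_indicator_iff measurableSet_Ioi).2 h2).integrableOn
  · rw [mellin]
    simp_rw [he]
    rw [setIntegral_indicator measurableSet_Ioi, inter_eq_self_of_subset_right
      (Ioi_subset_Ioi zero_le_one), h3]
    simp [neg_div]

lemma IsCutoff.mellin_regSum (h : IsCutoff ψ) {z : ℂ} (hz : z ≠ 0) :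
    mellin (regSum ψ) z = riemannZeta (1 - z) * mellinT ψ z + logMass ψ / z := by
  have hneg : ∀ z : ℂ, z.re < 0 →
      mellin (regSum ψ) z = riemannZeta (1 - z) * mellinT ψ z + logMass ψ / z := by
    intro z hz
    have h1 := h.hasMellin_dilSum hz
    have h2 := hasMellin_indicator_Ioi hz
    have h3 := hasMellin_const_smul h2.1 (logMass ψ : ℂ)
    have h4 := hasMellin_sub h1.1 h3.1
    rw [h1.2, h3.2, h2.2] at h4
    have h5 := h4.2
    have : mellin (regSum ψ) z = mellin (fun t => (dilSum ψ t : ℂ) -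
        (logMass ψ : ℂ) • indicator (Ioi 1) (fun _ => 1 : ℝ → ℂ) t) z := by
      rw [mellin, mellin]
      refine setIntegral_congr_fun measurableSet_Ioi fun t ht => ?_
      have ht' : (0 : ℝ) < t := ht
      simp only [regSum]
      by_cases h1 : t ≤ 1
      · simp [indicator, ht', h1, not_lt.2 h1]
      · simp [indicator, ht', h1, not_le.1 h1]
    rw [this, h5, smul_eq_mul]
    ring
  have hU : IsOpen ({0}ᶜ : Set ℂ) := isOpen_compl_singleton
  have hA : AnalyticOnNhd ℂ (mellin (regSum ψ)) {0}ᶜ :=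
    DifferentiableOn.analyticOnNhd
      (fun z _ => (h.regSum_aux z).2.differentiableWithinAt) hU
  have hB : AnalyticOnNhd ℂ (fun z => riemannZeta (1 - z) * mellinT ψ z + logMass ψ / z) {0}ᶜ := by
    refine DifferentiableOn.analyticOnNhd (fun z hz => ?_) hU
    have hz0 : z ≠ 0 := by simpa using hz
    have h1 : DifferentiableAt ℂ (fun z => riemannZeta (1 - z)) z :=
      (differentiableAt_riemannZeta (s := 1 - z) (by simpa using hz0)).comp z
        ((differentiableAt_const _).sub differentiableAt_id)
    exact ((h1.mul (h.differentiable_mellinT z)).add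
      ((differentiableAt_const _).div differentiableAt_id hz0)).differentiableWithinAt
  refine hA.eqOn_of_preconnected_of_eventuallyEq hB
    (isConnected_compl_singleton_of_one_lt_rank (by simp) 0).isPreconnected
    (show (-1 : ℂ) ∈ ({0}ᶜ : Set ℂ) by simp) ?_ (by simpa using hz)
  filter_upwards [(isOpen_lt Complex.continuous_re continuous_const).mem_nhds
    (show (-1 : ℂ) ∈ {z : ℂ | z.re < 0} by simp)] with z hz using hneg z hz

lemma IsCutoff.hasMellin_dilSum_sub (h : IsCutoff ψ) {z : ℂ} (hz : 0 < z.re) :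
    HasMellin (fun Y => ((dilSum ψ Y - logMass ψ : ℝ) : ℂ)) z
      (riemannZeta (1 - z) * mellinT ψ z) := by
  have hz0 : z ≠ 0 := fun h0 => by simp [h0] at hz
  have h2 := hasMellin_one_Ioc hz
  have h3 := hasMellin_const_smul h2.1 (logMass ψ : ℂ)
  have h4 := hasMellin_sub (h.regSum_aux z).1 h3.1
  rw [h3.2, h2.2, h.mellin_regSum hz0] at h4
  convert! h4 using 1
  · ext Y
    simp only [regSum, smul_eq_mul]
    ring
  · simp only [smul_eq_mul]
    ring

lemma IsCutoff.mellin_regSum_zero (h : IsCutoff ψ) :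
    mellin (regSum ψ) 0 = Real.eulerMascheroniConstant * logMass ψ + deriv (mellinT ψ) 0 := by
  have h1 : Tendsto (mellin (regSum ψ)) (𝓝[≠] 0) (𝓝 (mellin (regSum ψ) 0)) :=
    (h.regSum_aux 0).2.continuousAt.tendsto.mono_left nhdsWithin_le_nhds
  refine tendsto_nhds_unique h1 ?_
  have hlim : Tendsto (fun z : ℂ => 1 + z) (𝓝[≠] 0) (𝓝[≠] 1) := by
    refine tendsto_nhdsWithin_iff.2 ⟨?_, ?_⟩
    · have : ContinuousAt (fun z : ℂ => 1 + z) 0 := by fun_prop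
      simpa [ContinuousAt] using this.tendsto.mono_left nhdsWithin_le_nhds
    · filter_upwards [self_mem_nhdsWithin] with z hz
      simpa using hz
  have hneg : Tendsto (fun z : ℂ => -z) (𝓝[≠] 0) (𝓝[≠] 0) := by
    refine tendsto_nhdsWithin_iff.2 ⟨?_, ?_⟩
    · have : ContinuousAt (fun z : ℂ => -z) 0 := by fun_prop
      simpa [ContinuousAt] using this.tendsto.mono_left nhdsWithin_le_nhds
    · filter_upwards [self_mem_nhdsWithin] with z hz
      simpa using hz
  have hζ := tendsto_riemannZeta_sub_one_div.comp hlim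
  have hψ : Tendsto (mellinT ψ) (𝓝[≠] 0) (𝓝 (logMass ψ : ℂ)) := by
    rw [← h.mellinT_zero]
    exact h.differentiable_mellinT.continuous.continuousAt.tendsto.mono_left nhdsWithin_le_nhds
  have hd := (h.differentiable_mellinT 0).hasDerivAt.tendsto_slope_zero
  have hsum := ((hζ.mul hψ).add hd).comp hneg
  refine hsum.congr' ?_
  filter_upwards [self_mem_nhdsWithin] with z hz
  have hz0 : z ≠ 0 := by simpa using hz
  rw [h.mellin_regSum hz0]
  simp only [Function.comp_apply, h.mellinT_neg, zero_add, smul_eq_mul, h.mellinT_zero]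
  rw [← sub_eq_add_neg]
  have : (1 - z - 1) = -z := by ring
  rw [this]
  field_simp
  ring

end

section
open Filter Topology Asymptotics

variable {ψ ψ₁ ψ₂ : ℝ → ℝ}

open FourierTransform in
lemma IsCutoff.integrable_mellinT_vertical (h : IsCutoff ψ) (σ : ℝ) :
    Integrable (fun y : ℝ => mellinT ψ (σ + y * Complex.I)) := by
  obtain ⟨a, b, ha, hab, hs⟩ := exists_support_bounds h.compact h.pos
  have hsm : ContDiff ℝ (⊤ : ℕ∞) (fun u : ℝ => ((Real.exp (-σ * u) * ψ (Real.exp (-u)) : ℝ) : ℂ)) := by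
    have h1 : ContDiff ℝ (⊤ : ℕ∞) (fun u : ℝ => Real.exp (-u)) := Real.contDiff_exp.comp contDiff_neg
    have h2 : ContDiff ℝ (⊤ : ℕ∞) (fun u : ℝ => Real.exp (-σ * u)) :=
      Real.contDiff_exp.comp (contDiff_const.mul contDiff_id)
    exact Complex.ofRealCLM.contDiff.comp (h2.mul (h.smooth.comp h1))
  have hcs : HasCompactSupport
      (fun u : ℝ => ((Real.exp (-σ * u) * ψ (Real.exp (-u)) : ℝ) : ℂ)) := by
    refine HasCompactSupport.intro (K := Icc (-Real.log b) (-Real.log a)) isCompact_Icc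
      fun u hu => ?_
    have : ψ (Real.exp (-u)) = 0 := by
      by_contra h0
      obtain ⟨h1, h2⟩ := hs _ h0
      rw [← Real.log_lt_iff_lt_exp ha] at h1
      rw [← Real.lt_log_iff_exp_lt (ha.trans hab)] at h2
      exact hu ⟨by linarith, by linarith⟩
    simp [this]
  have hint := (𝓕 (hcs.toSchwartzMap hsm)).integrable (μ := volume)
  have h2π : (2 * Real.pi)⁻¹ ≠ 0 := by positivity
  convert! hint.comp_mul_right' h2π using 2 with y
  rw [h.mellinT_eq_mellin, mellin_eq_fourier, SchwartzMap.fourier_coe]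
  simp only [Complex.add_re, Complex.ofReal_re, Complex.mul_re, Complex.I_re, mul_zero,
    Complex.ofReal_im, Complex.I_im, mul_one, sub_self, add_zero, Complex.add_im, Complex.mul_im,
    zero_add, div_eq_mul_inv]
  have he : (fun u : ℝ => Real.exp (-σ * u) • (ψ (Real.exp (-u)) : ℂ)) =
      hcs.toSchwartzMap hsm := by
    funext u
    change _ = ((Real.exp (-σ * u) * ψ (Real.exp (-u)) : ℝ) : ℂ)
    rw [Complex.real_smul]
    push_cast
    rfl
  rw [he]

lemma integral_dilSum_mul_sub (h₁ : IsCutoff ψ₁) (h₂ : IsCutoff ψ₂) :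
    ∫ Y in Ioi (0 : ℝ),
        (((dilSum ψ₂ Y * (dilSum ψ₁ Y - logMass ψ₁)) / Y : ℝ) : ℂ) =
      1 / (2 * Real.pi) * ∫ t : ℝ, mellinT ψ₁ (-1 - t * Complex.I) *
        mellinT ψ₂ (1 + t * Complex.I) * riemannZeta (-(t * Complex.I)) *
        riemannZeta (2 + t * Complex.I) := by
  set M : ℝ → ℂ := fun y => riemannZeta (2 - y * Complex.I) * mellinT ψ₂ (-1 + y * Complex.I)
    with hM
  have hre : ∀ y : ℝ, (-1 + y * Complex.I : ℂ).re < 0 := fun y => by simp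
  have hmel : ∀ y : ℝ, mellin (fun Y => (dilSum ψ₂ Y : ℂ)) (-1 + y * Complex.I) = M y := fun y => by
    rw [(h₂.hasMellin_dilSum (hre y)).2, hM]
    ring_nf
  have hζ : ∀ y : ℝ, ‖riemannZeta (2 - y * Complex.I)‖ ≤ ∑' n : ℕ, 1 / (n : ℝ) ^ (2 : ℕ) := by
    intro y
    rw [zeta_eq_tsum_one_div_nat_cpow (by simp)]
    refine tsum_of_norm_bounded (Real.summable_one_div_nat_pow.2 one_lt_two).hasSum fun n => ?_
    rcases n.eq_zero_or_pos with rfl | hn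
    · simp only [Nat.cast_zero]
      rw [Complex.zero_cpow]
      · simp
      · intro h0
        have := congrArg Complex.re h0
        simp at this
    · rw [norm_div, norm_one, Complex.norm_natCast_cpow_of_pos hn]
      simp
  have hMint : Integrable M := by
    have h1 := h₂.integrable_mellinT_vertical (-1)
    push_cast at h1
    refine h1.bdd_mul ?_ (Eventually.of_forall hζ)
    refine Continuous.aestronglyMeasurable ?_
    rw [continuous_iff_continuousAt]
    intro y
    have : ContinuousAt riemannZeta (2 - y * Complex.I) :=
      (differentiableAt_riemannZeta fun h0 => by
        have := congrArg Complex.re h0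
        norm_num at this).continuousAt
    exact ContinuousAt.comp (f := fun y : ℝ => (2 - y * Complex.I : ℂ)) this (by fun_prop)
  have hinv : ∀ Y : ℝ, 0 < Y → (dilSum ψ₂ Y : ℂ) =
      1 / (2 * Real.pi) * ∫ y : ℝ, (Y : ℂ) ^ (1 - y * Complex.I) * M y := by
    intro Y hY
    have hv : Complex.VerticalIntegrable (mellin (fun Y => (dilSum ψ₂ Y : ℂ))) (-1 : ℝ) := by
      simp only [Complex.VerticalIntegrable]
      push_cast
      simp_rw [hmel]
      exact hMint
    have := mellinInv_mellin_eq (-1) (fun Y => (dilSum ψ₂ Y : ℂ)) hY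
      (h₂.hasMellin_dilSum (z := ((-1 : ℝ) : ℂ)) (by simp)).1 hv
      (Complex.continuous_ofReal.continuousAt.comp
        (h₂.continuousOn_dilSum.continuousAt (Ioi_mem_nhds hY)))
    rw [← this, mellinInv]
    push_cast
    simp_rw [hmel]
    rw [Complex.real_smul]
    push_cast
    congr 1
    refine integral_congr_ae (Eventually.of_forall fun y => ?_)
    simp only [smul_eq_mul]
    ring_nf
  set Φ : ℝ → ℂ := fun Y => ((dilSum ψ₁ Y - logMass ψ₁ : ℝ) : ℂ) with hΦ
  have hΦint : IntegrableOn Φ (Ioi 0) := by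
    have := (h₁.hasMellin_dilSum_sub (z := 1) (by simp)).1
    simpa [MellinConvergent, hΦ] using this
  have hΦmel : ∀ y : ℝ, ∫ Y in Ioi (0 : ℝ), (Y : ℂ) ^ (-(y * Complex.I)) * Φ Y =
      riemannZeta (y * Complex.I) * mellinT ψ₁ (1 - y * Complex.I) := by
    intro y
    have := (h₁.hasMellin_dilSum_sub (z := 1 - y * Complex.I) (by simp)).2
    rw [mellin] at this
    simp only [smul_eq_mul] at this
    rw [show (1 - (1 - y * Complex.I) : ℂ) = y * Complex.I by ring,
      show (1 - y * Complex.I - 1 : ℂ) = -(y * Complex.I) by ring] at this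
    exact this
  have hL : ∫ Y in Ioi (0 : ℝ),
        (((dilSum ψ₂ Y * (dilSum ψ₁ Y - logMass ψ₁)) / Y : ℝ) : ℂ) =
      1 / (2 * Real.pi) * ∫ Y in Ioi (0 : ℝ), ∫ y : ℝ,
        (Y : ℂ) ^ (-(y * Complex.I)) * Φ Y * M y := by
    rw [← integral_const_mul]
    refine setIntegral_congr_fun measurableSet_Ioi fun Y hY => ?_
    have hY0 : (0 : ℝ) < Y := hY
    have hYc : (Y : ℂ) ≠ 0 := by exact_mod_cast hY0.ne'
    have e1 : (((dilSum ψ₂ Y * (dilSum ψ₁ Y - logMass ψ₁)) / Y : ℝ) : ℂ) =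
        (dilSum ψ₂ Y : ℂ) * (Φ Y / Y) := by rw [hΦ]; push_cast; ring
    rw [e1, hinv Y hY0, mul_assoc, ← integral_mul_const]
    congr 1
    refine integral_congr_ae (Eventually.of_forall fun y => ?_)
    simp only []
    rw [show (1 - y * Complex.I : ℂ) = -(y * Complex.I) + 1 by ring, Complex.cpow_add _ _ hYc,
      Complex.cpow_one]
    field_simp
  rw [hL]
  congr 1
  rw [integral_integral_swap]
  · rw [← integral_neg_eq_self]
    refine integral_congr_ae (Eventually.of_forall fun t => ?_)
    simp only []
    rw [integral_mul_const, hΦmel, hM]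
    push_cast
    rw [show (1 - -(t : ℂ) * Complex.I) = -(-1 - t * Complex.I) by ring, h₁.mellinT_neg,
      show (-1 + -(t : ℂ) * Complex.I) = -(1 + t * Complex.I) by ring, h₂.mellinT_neg]
    ring_nf
  · have h1 := Integrable.mul_prod hΦint hMint
    refine h1.mono ?_ ?_
    · refine AEStronglyMeasurable.congr (f := fun z : ℝ × ℝ =>
        (z.1 : ℂ) ^ (-(z.2 * Complex.I)) * (Φ z.1 * M z.2)) ?_
          (Eventually.of_forall fun z => by simp [mul_assoc, Function.uncurry])
      refine AEStronglyMeasurable.mul ?_ h1.aestronglyMeasurable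
      exact Measurable.aestronglyMeasurable (by fun_prop)
    · have hpos : ∀ᵐ z ∂((volume.restrict (Ioi (0 : ℝ))).prod (volume : Measure ℝ)), 0 < z.1 :=
        (Measure.quasiMeasurePreserving_fst (μ := volume.restrict (Ioi (0 : ℝ)))
          (ν := (volume : Measure ℝ))).ae (ae_restrict_mem measurableSet_Ioi)
      filter_upwards [hpos] with z hz
      simp only [Function.uncurry, norm_mul]
      rw [Complex.norm_cpow_eq_rpow_re_of_pos hz]
      simp

end

section
open Filter Topology Asymptotics

variable {ψ ψ₁ ψ₂ : ℝ → ℝ}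

lemma IsCutoff.exists_dilSum_bounded (h : IsCutoff ψ) : ∃ C, 0 ≤ C ∧ ∀ Y, |dilSum ψ Y| ≤ C :=
  exists_dilSum_bound h.continuous h.compact h.pos

lemma IsCutoff.exists_dilSum_le_mul (h : IsCutoff ψ) :
    ∃ C, 0 ≤ C ∧ ∀ Y, 0 < Y → |dilSum ψ Y| ≤ C * Y := by
  obtain ⟨a, b, ha, hab, hs⟩ := exists_support_bounds h.compact h.pos
  obtain ⟨C, hC, hb⟩ := h.exists_dilSum_bounded
  refine ⟨C / a, by positivity, fun Y hY => ?_⟩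
  rcases le_or_gt Y a with hle | hlt
  · rw [dilSum_eq_zero ha (fun y hy => (hs y hy).1) hle, abs_zero]
    positivity
  · refine (hb Y).trans ?_
    rw [div_mul_eq_mul_div, le_div_iff₀ ha]
    gcongr

lemma IsCutoff.exists_dilSum_sub_le (h : IsCutoff ψ) :
    ∃ C, 0 ≤ C ∧ ∀ Y, 0 < Y → |dilSum ψ Y - logMass ψ| ≤ C * Y ^ (-(1 / 2) : ℝ) := by
  obtain ⟨C₁, hC₁, hb₁⟩ := h.exists_dilSum_bounded
  obtain ⟨C₂, hC₂, hb₂⟩ := h.exists_dilSum_sub_bound le_rfl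
  refine ⟨C₁ + |logMass ψ| + C₂, by positivity, fun Y hY => ?_⟩
  rcases le_or_gt Y 1 with hle | hlt
  · have h1 : 1 ≤ Y ^ (-(1 / 2) : ℝ) :=
      Real.one_le_rpow_of_pos_of_le_one_of_nonpos hY hle (by norm_num)
    have h2 : |dilSum ψ Y - logMass ψ| ≤ C₁ + |logMass ψ| :=
      (abs_sub _ _).trans (by gcongr; exact hb₁ Y)
    nlinarith [abs_nonneg (logMass ψ)]
  · have h1 : (Y ^ 2)⁻¹ ≤ Y ^ (-(1 / 2) : ℝ) := by
      rw [← Real.rpow_natCast, ← Real.rpow_neg hY.le]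
      exact Real.rpow_le_rpow_of_exponent_le hlt.le (by norm_num)
    have h2 := hb₂ Y hY
    rw [div_eq_mul_inv] at h2
    have h3 : 0 ≤ Y ^ (-(1 / 2) : ℝ) := by positivity
    nlinarith [abs_nonneg (logMass ψ), mul_le_mul_of_nonneg_left h1 hC₂,
      mul_nonneg (abs_nonneg (logMass ψ)) h3]

/-- The product of the two dilation sums. -/
noncomputable def dilProd (ψ₁ ψ₂ : ℝ → ℝ) (Y : ℝ) : ℝ := dilSum ψ₁ Y * dilSum ψ₂ Y

lemma exists_dilProd_bounded (h₁ : IsCutoff ψ₁) (h₂ : IsCutoff ψ₂) :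
    ∃ C, 0 ≤ C ∧ ∀ Y, |dilProd ψ₁ ψ₂ Y| ≤ C := by
  obtain ⟨C₁, hC₁, hb₁⟩ := h₁.exists_dilSum_bounded
  obtain ⟨C₂, hC₂, hb₂⟩ := h₂.exists_dilSum_bounded
  refine ⟨C₁ * C₂, by positivity, fun Y => ?_⟩
  rw [dilProd, abs_mul]
  exact mul_le_mul (hb₁ Y) (hb₂ Y) (abs_nonneg _) hC₁

lemma exists_dilProd_le_mul (h₁ : IsCutoff ψ₁) (h₂ : IsCutoff ψ₂) :
    ∃ C, 0 ≤ C ∧ ∀ Y, 0 < Y → |dilProd ψ₁ ψ₂ Y| ≤ C * Y := by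
  obtain ⟨C₁, hC₁, hb₁⟩ := h₁.exists_dilSum_bounded
  obtain ⟨C₂, hC₂, hb₂⟩ := h₂.exists_dilSum_le_mul
  refine ⟨C₁ * C₂, by positivity, fun Y hY => ?_⟩
  rw [dilProd, abs_mul, mul_assoc]
  exact mul_le_mul (hb₁ Y) (hb₂ Y hY) (abs_nonneg _) hC₁

lemma exists_dilProd_sub_le (h₁ : IsCutoff ψ₁) (h₂ : IsCutoff ψ₂) :
    ∃ C, 0 ≤ C ∧ ∀ Y, 0 < Y →
      |dilProd ψ₁ ψ₂ Y - logMass ψ₁ * logMass ψ₂| ≤ C * Y ^ (-(1 / 2) : ℝ) := by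
  obtain ⟨C₁, hC₁, hb₁⟩ := h₁.exists_dilSum_sub_le
  obtain ⟨C₂, hC₂, hb₂⟩ := h₂.exists_dilSum_sub_le
  obtain ⟨B, hB, hbB⟩ := h₂.exists_dilSum_bounded
  refine ⟨C₁ * B + |logMass ψ₁| * C₂, by positivity, fun Y hY => ?_⟩
  have : dilProd ψ₁ ψ₂ Y - logMass ψ₁ * logMass ψ₂ =
      (dilSum ψ₁ Y - logMass ψ₁) * dilSum ψ₂ Y + logMass ψ₁ * (dilSum ψ₂ Y - logMass ψ₂) := by
    rw [dilProd]; ring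
  rw [this]
  refine (abs_add_le _ _).trans ?_
  rw [abs_mul, abs_mul, add_mul, mul_right_comm, mul_assoc |logMass ψ₁|]
  have hY' : 0 ≤ Y ^ (-(1 / 2) : ℝ) := by positivity
  gcongr
  · exact hb₁ Y hY
  · exact hbB Y
  · exact hb₂ Y hY

lemma continuousOn_dilProd (h₁ : IsCutoff ψ₁) (h₂ : IsCutoff ψ₂) :
    ContinuousOn (dilProd ψ₁ ψ₂) (Ioi 0) :=
  h₁.continuousOn_dilSum.mul h₂.continuousOn_dilSum

/-- The regularised integral of `dilProd ψ₁ ψ₂` against `dY / Y`. -/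
noncomputable def regMass (ψ₁ ψ₂ : ℝ → ℝ) : ℝ :=
  ∫ Y in Ioi (0 : ℝ),
    (dilProd ψ₁ ψ₂ Y - logMass ψ₁ * logMass ψ₂ * indicator (Ioi 1) (fun _ => 1) Y) / Y

lemma regMass_aux (h₁ : IsCutoff ψ₁) (h₂ : IsCutoff ψ₂) :
    IntegrableOn (fun Y => (dilProd ψ₁ ψ₂ Y -
      logMass ψ₁ * logMass ψ₂ * indicator (Ioi 1) (fun _ => 1) Y) / Y) (Ioi 0) ∧
    (regMass ψ₁ ψ₂ : ℂ) = Real.eulerMascheroniConstant * mellinT ψ₁ 0 * mellinT ψ₂ 0 +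
      mellinT ψ₁ 0 * deriv (mellinT ψ₂) 0 +
      1 / (2 * Real.pi) * ∫ t : ℝ, mellinT ψ₁ (-1 - t * Complex.I) *
        mellinT ψ₂ (1 + t * Complex.I) * riemannZeta (-(t * Complex.I)) *
        riemannZeta (2 + t * Complex.I) := by
  obtain ⟨C, hC, hCb⟩ := h₂.exists_dilSum_le_mul
  have hA : IntegrableOn (fun Y => (((dilSum ψ₂ Y * (dilSum ψ₁ Y - logMass ψ₁)) / Y : ℝ) : ℂ))
      (Ioi 0) := by
    have h0 : IntegrableOn (fun Y => ((dilSum ψ₁ Y - logMass ψ₁ : ℝ) : ℂ)) (Ioi 0) := by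
      have := (h₁.hasMellin_dilSum_sub (z := 1) (by simp)).1
      simpa [MellinConvergent] using this
    refine (h0.const_mul (C : ℂ)).mono ?_ ?_
    · refine ContinuousOn.aestronglyMeasurable ?_ measurableSet_Ioi
      refine Complex.continuous_ofReal.comp_continuousOn ?_
      exact (h₂.continuousOn_dilSum.mul (h₁.continuousOn_dilSum.sub continuousOn_const)).div
        continuousOn_id fun y hy => ne_of_gt hy
    · filter_upwards [ae_restrict_mem measurableSet_Ioi] with Y hY
      have hY0 : (0 : ℝ) < Y := hY
      rw [norm_mul, Complex.norm_real, Complex.norm_real, Complex.norm_real, Real.norm_eq_abs,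
        Real.norm_eq_abs, Real.norm_eq_abs, abs_div, abs_mul, abs_of_pos hY0, abs_of_nonneg hC,
        div_le_iff₀ hY0, mul_right_comm]
      gcongr
      exact hCb Y hY0
  have hpow : ∀ Y : ℝ, (Y : ℂ) ^ (0 - 1 : ℂ) • regSum ψ₂ Y = regSum ψ₂ Y / Y := fun Y => by
    rw [zero_sub, Complex.cpow_neg_one, smul_eq_mul, div_eq_inv_mul]
  have hB : IntegrableOn (fun Y : ℝ => regSum ψ₂ Y / Y) (Ioi 0) := by
    have := (h₂.regSum_aux 0).1
    simpa only [MellinConvergent, hpow] using this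
  have hBval : ∫ Y in Ioi (0 : ℝ), regSum ψ₂ Y / Y =
      Real.eulerMascheroniConstant * logMass ψ₂ + deriv (mellinT ψ₂) 0 := by
    rw [← h₂.mellin_regSum_zero, mellin]
    simp only [hpow]
  have hsum : EqOn (fun Y : ℝ => (((dilProd ψ₁ ψ₂ Y -
      logMass ψ₁ * logMass ψ₂ * indicator (Ioi 1) (fun _ => 1) Y) / Y : ℝ) : ℂ))
      (fun Y => (((dilSum ψ₂ Y * (dilSum ψ₁ Y - logMass ψ₁)) / Y : ℝ) : ℂ) +
        (logMass ψ₁ : ℂ) * (regSum ψ₂ Y / Y)) (Ioi 0) := by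
    intro Y hY
    have hY0 : (0 : ℝ) < Y := hY
    by_cases h1 : Y ≤ 1
    · simp only [dilProd, regSum, indicator, mem_Ioi, mem_Ioc, not_lt.2 h1, h1, hY0, and_self,
        if_true, if_false]
      push_cast
      ring
    · simp only [dilProd, regSum, indicator, mem_Ioi, mem_Ioc, not_le.1 h1, h1, hY0, and_false,
        if_true, if_false]
      push_cast
      ring
  have hint := (integrableOn_congr_fun hsum measurableSet_Ioi).2 (hA.add (hB.const_mul _))
  refine ⟨?_, ?_⟩
  · simpa [IntegrableOn] using hint.re
  · rw [regMass, ← integral_complex_ofReal, setIntegral_congr_fun measurableSet_Ioi hsum,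
      integral_add hA (hB.const_mul _), integral_const_mul, hBval,
      integral_dilSum_mul_sub h₁ h₂, h₁.mellinT_zero, h₂.mellinT_zero]
    ring

end

section
open Filter Topology Asymptotics

lemma iUnion_Ioc_natCast : ⋃ n : ℕ, Ioc (n : ℝ) (n + 1 : ℕ) = Ioi 0 := by
  ext x
  simp only [mem_iUnion, mem_Ioc, mem_Ioi]
  constructor
  · rintro ⟨n, hn, -⟩
    exact (Nat.cast_nonneg n).trans_lt hn
  · intro hx
    have hc : 0 < ⌈x⌉₊ := Nat.ceil_pos.2 hx
    obtain ⟨k, hk⟩ := Nat.exists_eq_succ_of_ne_zero hc.ne'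
    refine ⟨k, Nat.lt_ceil.1 (by omega), ?_⟩
    rw [← Nat.succ_eq_add_one, ← hk]
    exact Nat.le_ceil x

/-- Comparison of a sum over the positive integers with the corresponding integral. -/
lemma abs_tsum_sub_integral_le {φ φ' : ℝ → ℝ} (hd : ∀ x, 0 < x → HasDerivAt φ (φ' x) x)
    (hφ : IntegrableOn φ (Ioi 0)) (hφ' : IntegrableOn φ' (Ioi 0)) :
    Summable (fun n : ℕ => φ (n + 1 : ℕ)) ∧
      |∑' n : ℕ, φ (n + 1 : ℕ) - ∫ x in Ioi (0 : ℝ), φ x| ≤ ∫ x in Ioi (0 : ℝ), |φ' x| := by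
  have hdisj : Pairwise (Function.onFun Disjoint fun n : ℕ => Ioc (n : ℝ) (n + 1 : ℕ)) :=
    (Nat.mono_cast (α := ℝ)).pairwise_disjoint_on_Ioc_succ
  have hsub : ∀ n : ℕ, Ioc (n : ℝ) (n + 1 : ℕ) ⊆ Ioi 0 := fun n x hx =>
    (Nat.cast_nonneg n).trans_lt hx.1
  have key : ∀ f : ℝ → ℝ, IntegrableOn f (Ioi 0) →
      HasSum (fun n : ℕ => ∫ x in Ioc (n : ℝ) (n + 1 : ℕ), f x) (∫ x in Ioi (0 : ℝ), f x) := by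
    intro f hf
    rw [← iUnion_Ioc_natCast]
    exact hasSum_integral_iUnion (fun n => measurableSet_Ioc) hdisj
      (by rw [iUnion_Ioc_natCast]; exact hf)
  have h1 := key φ hφ
  have h2 := key (fun x => |φ' x|) hφ'.abs
  have hb : ∀ n : ℕ, ‖φ (n + 1 : ℕ) - ∫ x in Ioc (n : ℝ) (n + 1 : ℕ), φ x‖ ≤
      ∫ x in Ioc (n : ℝ) (n + 1 : ℕ), |φ' x| := by
    intro n
    have hlen : volume.real (Ioc (n : ℝ) (n + 1 : ℕ)) = 1 := by simp
    have hi : ∀ x ∈ Ioc (n : ℝ) (n + 1 : ℕ), |φ (n + 1 : ℕ) - φ x| ≤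
        ∫ x in Ioc (n : ℝ) (n + 1 : ℕ), |φ' x| := by
      intro x hx
      have hx0 : 0 < x := hsub n hx
      have hsub' : Ioc x (n + 1 : ℕ) ⊆ Ioc (n : ℝ) (n + 1 : ℕ) := Ioc_subset_Ioc_left hx.1.le
      rw [← intervalIntegral.integral_eq_sub_of_hasDerivAt (a := x) (b := (n + 1 : ℕ))
        (f' := φ') (fun y hy => hd y ?A) ?B]
      · rw [intervalIntegral.integral_of_le hx.2]
        refine (abs_integral_le_integral_abs).trans ?_
        exact setIntegral_mono_set ((hφ'.mono_set (hsub n)).abs)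
          (Eventually.of_forall fun _ => abs_nonneg _) hsub'.eventuallyLE
      case A =>
        rw [uIcc_of_le hx.2] at hy
        exact hx0.trans_le hy.1
      case B =>
        rw [intervalIntegrable_iff_integrableOn_Ioc_of_le hx.2]
        exact hφ'.mono_set (hsub'.trans (hsub n))
    have he : φ (n + 1 : ℕ) - ∫ x in Ioc (n : ℝ) (n + 1 : ℕ), φ x =
        ∫ x in Ioc (n : ℝ) (n + 1 : ℕ), (φ (n + 1 : ℕ) - φ x) := by
      have hc : IntegrableOn (fun _ : ℝ => φ (n + 1 : ℕ)) (Ioc (n : ℝ) (n + 1 : ℕ)) :=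
        integrableOn_const (by simp)
      rw [integral_sub hc (hφ.mono_set (hsub n)), setIntegral_const, hlen, one_smul]
    rw [he]
    refine (norm_setIntegral_le_of_norm_le_const (by simp) hi).trans ?_
    rw [hlen, mul_one]
  have he := Summable.of_norm_bounded h2.summable hb
  have hs : Summable (fun n : ℕ => φ (n + 1 : ℕ)) := by
    simpa using he.add h1.summable
  refine ⟨hs, ?_⟩
  have : ∑' n : ℕ, φ (n + 1 : ℕ) - ∫ x in Ioi (0 : ℝ), φ x =
      ∑' n : ℕ, (φ (n + 1 : ℕ) - ∫ x in Ioc (n : ℝ) (n + 1 : ℕ), φ x) := by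
    rw [hs.tsum_sub h1.summable, h1.tsum_eq]
  rw [this]
  exact tsum_of_norm_bounded h2 hb

/-- `∑_{m ≥ 1} exp (-a m²)`. -/
noncomputable def thetaSum (a : ℝ) : ℝ := ∑' m : ℕ, Real.exp (-(a * ((m + 1 : ℕ) : ℝ) ^ 2))

lemma thetaSum_aux {a : ℝ} (ha : 0 < a) :
    Summable (fun m : ℕ => Real.exp (-(a * ((m + 1 : ℕ) : ℝ) ^ 2))) ∧
      |thetaSum a - Real.sqrt (Real.pi / a) / 2| ≤ 1 := by
  have hd : ∀ x : ℝ, 0 < x → HasDerivAt (fun x => Real.exp (-(a * x ^ 2)))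
      (-(2 * a * x) * Real.exp (-(a * x ^ 2))) x := by
    intro x hx
    have := (((hasDerivAt_pow 2 x).const_mul a).neg).exp
    convert! this using 1
    simp
    ring
  have hint : IntegrableOn (fun x : ℝ => Real.exp (-(a * x ^ 2))) (Ioi 0) := by
    simpa using (integrable_exp_neg_mul_sq ha).integrableOn
  have hlim : Tendsto (fun x : ℝ => Real.exp (-(a * x ^ 2))) atTop (𝓝 0) := by
    refine Real.tendsto_exp_atBot.comp (tendsto_neg_atTop_atBot.comp ?_)
    exact (tendsto_pow_atTop two_ne_zero).const_mul_atTop ha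
  have hcont : ContinuousWithinAt (fun x : ℝ => Real.exp (-(a * x ^ 2))) (Ici 0) 0 := by
    fun_prop
  have hd' := fun x (hx : x ∈ Ioi (0 : ℝ)) => hd x hx
  have hneg : ∀ x ∈ Ioi (0 : ℝ), -(2 * a * x) * Real.exp (-(a * x ^ 2)) ≤ 0 := by
    intro x hx
    have hx' : (0 : ℝ) < x := hx
    have : 0 ≤ (2 * a * x) * Real.exp (-(a * x ^ 2)) := by positivity
    linarith
  have hint' := integrableOn_Ioi_deriv_of_nonpos hcont hd' hneg hlim
  have hval := integral_Ioi_of_hasDerivAt_of_nonpos hcont hd' hneg hlim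
  have := abs_tsum_sub_integral_le hd hint hint'
  refine ⟨this.1, ?_⟩
  have h2 := this.2
  have hg : ∫ x in Ioi (0 : ℝ), Real.exp (-(a * x ^ 2)) = Real.sqrt (Real.pi / a) / 2 := by
    simpa using integral_gaussian_Ioi a
  rw [hg] at h2
  refine h2.trans_eq ?_
  rw [setIntegral_congr_fun measurableSet_Ioi (g := fun x => -(-(2 * a * x) * Real.exp (-(a * x ^ 2))))
    fun x hx => abs_of_nonpos (hneg x hx), integral_neg, hval]
  simp

end

section
open Filter Topology Asymptotics

lemma antitoneOn_thetaSum : AntitoneOn thetaSum (Ioi 0) := by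
  intro a ha b hb hab
  refine Summable.tsum_le_tsum (fun m => ?_) (thetaSum_aux hb).1 (thetaSum_aux ha).1
  gcongr

lemma thetaSum_nonneg (a : ℝ) : 0 ≤ thetaSum a := tsum_nonneg fun _ => (Real.exp_pos _).le

lemma thetaSum_le_exp {a : ℝ} (ha : 1 ≤ a) :
    thetaSum a ≤ thetaSum (1 / 2) * Real.exp (-(1 / 2) * a) := by
  have ha0 : 0 < a := by linarith
  have h1 : thetaSum a ≤ thetaSum (a / 2) * Real.exp (-(1 / 2) * a) := by
    rw [thetaSum, thetaSum, ← tsum_mul_right]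
    refine Summable.tsum_le_tsum (fun m => ?_) (thetaSum_aux ha0).1
      ((thetaSum_aux (half_pos ha0)).1.mul_right _)
    rw [← Real.exp_add, Real.exp_le_exp]
    have : (1 : ℝ) ≤ ((m + 1 : ℕ) : ℝ) ^ 2 := by
      have : (1 : ℝ) ≤ ((m + 1 : ℕ) : ℝ) := by exact_mod_cast Nat.le_add_left 1 m
      exact one_le_pow₀ this
    nlinarith
  refine h1.trans ?_
  gcongr
  refine antitoneOn_thetaSum ?_ ?_ ?_ <;> simp <;> linarith

/-- `thetaSum` with its singular part at the origin removed on `(0, 1]`. -/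
noncomputable def regTheta (a : ℝ) : ℝ :=
  thetaSum a - Real.sqrt Real.pi / 2 * indicator (Ioc 0 1) (fun a : ℝ => a ^ (-(1 / 2) : ℝ)) a

lemma ofReal_regTheta (a : ℝ) : (regTheta a : ℂ) = (thetaSum a : ℂ) -
    ((Real.sqrt Real.pi / 2 : ℝ) : ℂ) • indicator (Ioc 0 1) (fun a : ℝ => (a : ℂ) ^ (-(1 / 2) : ℂ)) a := by
  by_cases ha : a ∈ Ioc (0 : ℝ) 1
  · simp only [regTheta, indicator_of_mem ha, smul_eq_mul]
    push_cast
    rw [Complex.ofReal_cpow ha.1.le]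
    push_cast
    rfl
  · simp [regTheta, indicator_of_notMem ha]

lemma abs_regTheta_le {a : ℝ} (ha : 0 < a) (ha1 : a ≤ 1) : |regTheta a| ≤ 1 := by
  refine (le_of_eq ?_).trans (thetaSum_aux ha).2
  rw [regTheta, indicator_of_mem (show a ∈ Ioc (0 : ℝ) 1 from ⟨ha, ha1⟩), Real.sqrt_div' _ ha.le, Real.rpow_neg ha.le,
    ← Real.sqrt_eq_rpow]
  congr 1
  ring

lemma regTheta_aux {z : ℂ} (hz : 0 < z.re) :
    MellinConvergent (fun a => (regTheta a : ℂ)) z ∧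
      DifferentiableAt ℂ (mellin (fun a => (regTheta a : ℂ))) z := by
  have hloc : LocallyIntegrableOn (fun a => (regTheta a : ℂ)) (Ioi 0) := by
    have h1 : LocallyIntegrableOn (fun a => (thetaSum a : ℂ)) (Ioi 0) := by
      rw [locallyIntegrableOn_iff isOpen_Ioi.isLocallyClosed]
      intro k hk hkc
      exact ((antitoneOn_thetaSum.mono hk).integrableOn_isCompact hkc).ofReal
    have h2 : LocallyIntegrableOn (indicator (Ioc 0 1) (fun a : ℝ => (a : ℂ) ^ (-(1 / 2) : ℂ)))
        (Ioi 0) := by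
      have := (hasMellin_cpow_Ioc (-(1 / 2)) (s := 1) (by norm_num)).1
      simp only [MellinConvergent, sub_self, Complex.cpow_zero, one_smul] at this
      exact this.locallyIntegrableOn
    have h3 := h1.sub (h2.smul ((Real.sqrt Real.pi / 2 : ℝ) : ℂ))
    rw [show (fun a => (regTheta a : ℂ)) = _ from funext ofReal_regTheta]
    exact h3
  have htop : (fun a => (regTheta a : ℂ)) =O[atTop] (· ^ (-(z.re + 1)) : ℝ → ℝ) := by
    have h1 : (fun a => (regTheta a : ℂ)) =O[atTop] (fun a => Real.exp (-(1 / 2) * a)) := by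
      refine IsBigO.of_bound (thetaSum (1 / 2)) ?_
      filter_upwards [eventually_gt_atTop 1] with a ha
      rw [regTheta, indicator_of_notMem (by simp [ha]), mul_zero, sub_zero, Complex.norm_real,
        Real.norm_of_nonneg (thetaSum_nonneg a), Real.norm_of_nonneg (Real.exp_pos _).le]
      exact thetaSum_le_exp ha.le
    exact h1.trans (isLittleO_exp_neg_mul_rpow_atTop (by norm_num) _).isBigO
  have hbot : (fun a => (regTheta a : ℂ)) =O[𝓝[>] 0] (· ^ (-(0 : ℝ)) : ℝ → ℝ) := by
    refine IsBigO.of_bound 1 ?_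
    filter_upwards [Ioo_mem_nhdsGT one_pos] with a ha
    simpa using abs_regTheta_le ha.1 ha.2.le
  exact ⟨mellinConvergent_of_isBigO_rpow hloc htop (by linarith) hbot hz,
    mellin_differentiableAt_of_isBigO_rpow hloc htop (by linarith) hbot hz⟩

lemma mellin_thetaSum {z : ℂ} (hz : 1 / 2 < z.re) :
    mellin (fun a => (thetaSum a : ℂ)) z = Complex.Gamma z * riemannZeta (2 * z) := by
  have h := hasSum_mellin (a := fun _ : ℕ => (1 : ℂ)) (p := fun m : ℕ => ((m + 1 : ℕ) : ℝ) ^ 2)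
    (F := fun a => (thetaSum a : ℂ)) (s := z) (fun m => Or.inr (by positivity)) (by linarith)
    (fun t ht => ?_) ?_
  · have hz2 : 1 < (2 * z).re := by simp; linarith
    rw [zeta_eq_tsum_one_div_nat_add_one_cpow hz2, ← tsum_mul_left, ← h.tsum_eq]
    refine tsum_congr fun m => ?_
    have : ((((m + 1 : ℕ) : ℝ) ^ 2 : ℝ) : ℂ) ^ z = ((m : ℂ) + 1) ^ (2 * z) := by
      rw [Complex.cpow_ofNat_mul]
      push_cast
      rw [show ((m : ℂ) + 1) = ((m + 1 : ℕ) : ℂ) by push_cast; rfl, sq,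
        Complex.natCast_mul_natCast_cpow, sq]
    rw [this]
    ring
  · have := Complex.hasSum_ofReal.2 (thetaSum_aux (a := t) ht).1.hasSum
    simp only [one_mul]
    convert! this using 3 with m
    · congr 1
      ring
  · have h1 : (1 : ℝ) < 2 * z.re := by linarith
    have := (summable_nat_add_iff 1).2 (Real.summable_one_div_nat_rpow.2 h1)
    refine this.congr fun m => ?_
    rw [norm_one, Real.rpow_mul (by positivity)]
    norm_cast

lemma mellin_regTheta_half : mellin (fun a => (regTheta a : ℂ)) (1 / 2) =
    ((Real.sqrt Real.pi * (Real.eulerMascheroniConstant / 2 - Real.log 2) : ℝ) : ℂ) := by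
  have hval : ∀ z : ℂ, 1 / 2 < z.re → mellin (fun a => (regTheta a : ℂ)) z =
      Complex.Gamma z * riemannZeta (2 * z) -
        ((Real.sqrt Real.pi / 2 : ℝ) : ℂ) / (z - 1 / 2) := by
    intro z hz
    have h1 := hasMellin_cpow_Ioc (-(1 / 2)) (s := z) (by norm_num; linarith)
    have h2 := hasMellin_const_smul h1.1 ((Real.sqrt Real.pi / 2 : ℝ) : ℂ)
    have h3 := hasMellin_add (regTheta_aux (z := z) (by linarith)).1 h2.1
    have h4 : (fun a => (thetaSum a : ℂ)) = fun t => (regTheta t : ℂ) +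
        ((Real.sqrt Real.pi / 2 : ℝ) : ℂ) •
          indicator (Ioc 0 1) (fun a : ℝ => (a : ℂ) ^ (-(1 / 2) : ℂ)) t := by
      funext a
      rw [ofReal_regTheta]
      ring
    rw [← mellin_thetaSum hz, h4, h3.2, h2.2, h1.2, smul_eq_mul]
    ring
  have hw : Tendsto (fun w : ℝ => (1 / 2 + w : ℂ)) (𝓝[>] 0) (𝓝 (1 / 2)) := by
    have : ContinuousAt (fun w : ℝ => (1 / 2 + w : ℂ)) 0 := by fun_prop
    simpa [ContinuousAt] using this.tendsto.mono_left nhdsWithin_le_nhds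
  have h1 : Tendsto (fun w : ℝ => mellin (fun a => (regTheta a : ℂ)) (1 / 2 + w)) (𝓝[>] 0)
      (𝓝 (mellin (fun a => (regTheta a : ℂ)) (1 / 2))) :=
    (regTheta_aux (z := 1 / 2) (by norm_num)).2.continuousAt.tendsto.comp hw
  refine tendsto_nhds_unique h1 ?_
  have hw1 : Tendsto (fun w : ℝ => (1 + 2 * w : ℂ)) (𝓝[>] 0) (𝓝[≠] 1) := by
    refine tendsto_nhdsWithin_iff.2 ⟨?_, ?_⟩
    · have : ContinuousAt (fun w : ℝ => (1 + 2 * w : ℂ)) 0 := by fun_prop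
      simpa [ContinuousAt] using this.tendsto.mono_left nhdsWithin_le_nhds
    · filter_upwards [self_mem_nhdsWithin] with w hw
      have : (w : ℝ) ≠ 0 := ne_of_gt hw
      simpa using this
  have hw0 : Tendsto (fun w : ℝ => (w : ℂ)) (𝓝[>] 0) (𝓝[≠] 0) := by
    refine tendsto_nhdsWithin_iff.2 ⟨?_, ?_⟩
    · have : ContinuousAt (fun w : ℝ => (w : ℂ)) 0 := by fun_prop
      simpa [ContinuousAt] using this.tendsto.mono_left nhdsWithin_le_nhds
    · filter_upwards [self_mem_nhdsWithin] with w hw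
      have : (w : ℝ) ≠ 0 := ne_of_gt hw
      simpa using this
  have hζ := tendsto_riemannZeta_sub_one_div.comp hw1
  have hΓ := Complex.hasDerivAt_Gamma_one_half.continuousAt.tendsto.comp hw
  have hd := (Complex.hasDerivAt_Gamma_one_half.tendsto_slope_zero.comp hw0).mul_const (1 / 2)
  have hG : Complex.Gamma (1 / 2) = (Real.sqrt Real.pi : ℂ) := by
    rw [← Real.Gamma_one_half_eq, ← Complex.Gamma_ofReal]
    push_cast
    rfl
  have hsum := (hΓ.mul hζ).add hd
  rw [hG] at hsum
  have hlog : Complex.log 2 = (Real.log 2 : ℂ) := by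
    rw [Complex.ofReal_log (by norm_num)]; norm_num
  convert! hsum.congr' ?_ using 2
  · rw [hlog]
    push_cast
    ring
  · filter_upwards [self_mem_nhdsWithin] with w hw
    have hw0 : (0 : ℝ) < w := hw
    have hwc : (w : ℂ) ≠ 0 := by exact_mod_cast hw0.ne'
    rw [hval _ (by simpa using hw0)]
    simp only [Function.comp_apply, smul_eq_mul]
    push_cast
    rw [show (2 * (1 / 2 + w) : ℂ) = 1 + 2 * w by ring]
    field_simp
    ring

end

section
open Filter Topology Asymptotics

lemma regTheta_sq_aux {r : ℝ} (hr : -1 < r) :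
    MellinConvergent (fun s : ℝ => (regTheta (s ^ 2) : ℂ)) (r + 1 : ℝ) := by
  have := (MellinConvergent.comp_rpow (f := fun a => (regTheta a : ℂ)) (s := (r + 1 : ℝ))
    (a := 2) two_ne_zero).2 (regTheta_aux (by
      rw [← Complex.ofReal_div, Complex.ofReal_re]; linarith)).1
  simpa using this

lemma integrableOn_regTheta_sq {r : ℝ} (hr : -1 < r) :
    IntegrableOn (fun s : ℝ => s ^ r * regTheta (s ^ 2)) (Ioi 0) := by
  have h1 := (regTheta_sq_aux hr)
  rw [MellinConvergent] at h1
  have h2 : EqOn (fun t : ℝ => (t : ℂ) ^ (((r + 1 : ℝ) : ℂ) - 1) • (regTheta (t ^ 2) : ℂ))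
      (fun s : ℝ => ((s ^ r * regTheta (s ^ 2) : ℝ) : ℂ)) (Ioi 0) := by
    intro t ht
    simp only [smul_eq_mul]
    rw [Complex.ofReal_mul, Complex.ofReal_cpow (le_of_lt ht)]
    push_cast
    ring_nf
  have h3 := ((integrableOn_congr_fun h2 measurableSet_Ioi).1 h1).re
  simpa [IntegrableOn] using h3

lemma integral_regTheta_sq :
    ∫ s in Ioi (0 : ℝ), regTheta (s ^ 2) =
      Real.sqrt Real.pi / 2 * (Real.eulerMascheroniConstant / 2 - Real.log 2) := by
  have h1 := mellin_comp_rpow (fun a => (regTheta a : ℂ)) 1 2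
  rw [show (1 / (2 : ℝ) : ℂ) = 1 / 2 by norm_num, mellin_regTheta_half, mellin] at h1
  simp only [sub_self, Complex.cpow_zero, one_smul, Real.rpow_ofNat] at h1
  rw [integral_complex_ofReal, Complex.real_smul, ← Complex.ofReal_mul] at h1
  rw [Complex.ofReal_injective h1, abs_of_pos two_pos]
  ring

variable {P : ℝ → ℝ} {p C C' : ℝ}

lemma integrableOn_div_self_Ioc (hcont : ContinuousOn P (Ioi 0))
    (hlin : ∀ Y, 0 < Y → |P Y| ≤ C' * Y) (Λ : ℝ) :
    IntegrableOn (fun Y => P Y / Y) (Ioc 0 Λ) := by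
  refine Integrable.mono' (g := fun _ => C') (integrableOn_const (by simp)) ?_ ?_
  · exact ((hcont.div continuousOn_id fun y hy => ne_of_gt hy).mono
      Ioc_subset_Ioi_self).aestronglyMeasurable measurableSet_Ioc
  · filter_upwards [ae_restrict_mem measurableSet_Ioc] with Y hY
    rw [Real.norm_eq_abs, abs_div, abs_of_pos hY.1, div_le_iff₀ hY.1]
    exact hlin Y hY.1

lemma abs_integral_Ioc_div_self_sub_le (hcont : ContinuousOn P (Ioi 0))
    (hlin : ∀ Y, 0 < Y → |P Y| ≤ C' * Y)
    (hsub : ∀ Y, 0 < Y → |P Y - p| ≤ C * Y ^ (-(1 / 2) : ℝ))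
    (hint : IntegrableOn (fun Y => (P Y - p * indicator (Ioi 1) (fun _ => 1) Y) / Y) (Ioi 0))
    {Λ : ℝ} (hΛ : 1 ≤ Λ) :
    |(∫ Y in Ioc 0 Λ, P Y / Y) - (p * Real.log Λ +
      ∫ Y in Ioi (0 : ℝ), (P Y - p * indicator (Ioi 1) (fun _ => 1) Y) / Y)| ≤
      2 * C * Λ ^ (-(1 / 2) : ℝ) := by
  have hΛ0 : 0 < Λ := by linarith
  have hP := integrableOn_div_self_Ioc hcont hlin Λ
  have hI : IntegrableOn (fun Y : ℝ => indicator (Ioi 1) (fun Y => Y⁻¹) Y) (Ioc 0 Λ) := by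
    rw [IntegrableOn, integrable_indicator_iff measurableSet_Ioi, IntegrableOn,
      Measure.restrict_restrict measurableSet_Ioi, inter_comm, Ioc_inter_Ioi,
      max_eq_right zero_le_one]
    refine (ContinuousOn.integrableOn_Icc ?_).mono_set Ioc_subset_Icc_self
    exact continuousOn_inv₀.mono fun y hy => (ne_of_gt (by linarith [hy.1]) : y ≠ 0)
  have hsplit : ∫ Y in Ioi (0 : ℝ), (P Y - p * indicator (Ioi 1) (fun _ => 1) Y) / Y =
      (∫ Y in Ioc 0 Λ, (P Y - p * indicator (Ioi 1) (fun _ => 1) Y) / Y) +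
      ∫ Y in Ioi Λ, (P Y - p * indicator (Ioi 1) (fun _ => 1) Y) / Y := by
    rw [← setIntegral_union Ioc_disjoint_Ioi_same measurableSet_Ioi
      (hint.mono_set Ioc_subset_Ioi_self) (hint.mono_set (Ioi_subset_Ioi hΛ0.le)),
      Ioc_union_Ioi_eq_Ioi hΛ0.le]
  have h1 : ∫ Y in Ioc 0 Λ, (P Y - p * indicator (Ioi 1) (fun _ => 1) Y) / Y =
      (∫ Y in Ioc 0 Λ, P Y / Y) - p * Real.log Λ := by
    have he : ∀ Y : ℝ, (P Y - p * indicator (Ioi 1) (fun _ => 1) Y) / Y =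
        P Y / Y - p * indicator (Ioi 1) (fun Y => Y⁻¹) Y := fun Y => by
      by_cases hY : Y ∈ Ioi (1 : ℝ)
      · rw [indicator_of_mem hY, indicator_of_mem hY]; ring
      · rw [indicator_of_notMem hY, indicator_of_notMem hY]; ring
    simp_rw [he]
    rw [integral_sub hP (hI.const_mul _), integral_const_mul,
      setIntegral_indicator measurableSet_Ioi, Ioc_inter_Ioi, max_eq_right zero_le_one,
      ← intervalIntegral.integral_of_le hΛ, integral_inv_of_pos one_pos hΛ0, div_one]
  have h2 : |∫ Y in Ioi Λ, (P Y - p * indicator (Ioi 1) (fun _ => 1) Y) / Y| ≤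
      2 * C * Λ ^ (-(1 / 2) : ℝ) := by
    have hi : IntegrableOn (fun Y : ℝ => C * Y ^ (-(3 / 2) : ℝ)) (Ioi Λ) :=
      (integrableOn_Ioi_rpow_of_lt (by norm_num) hΛ0).const_mul C
    have := norm_integral_le_of_norm_le hi
      (f := fun Y => (P Y - p * indicator (Ioi 1) (fun _ => 1) Y) / Y) (by
        filter_upwards [ae_restrict_mem measurableSet_Ioi] with Y hY
        have hY1 : Y ∈ Ioi (1 : ℝ) := lt_of_le_of_lt hΛ hY
        have hY0 : 0 < Y := one_pos.trans hY1
        rw [indicator_of_mem hY1, mul_one, Real.norm_eq_abs, abs_div, abs_of_pos hY0,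
          div_le_iff₀ hY0, mul_assoc, ← Real.rpow_add_one hY0.ne']
        convert! hsub Y hY0 using 3
        norm_num)
    refine this.trans_eq ?_
    rw [integral_const_mul, integral_Ioi_rpow_of_lt (by norm_num) hΛ0]
    norm_num
    ring
  have : (∫ Y in Ioc 0 Λ, P Y / Y) - (p * Real.log Λ +
      ∫ Y in Ioi (0 : ℝ), (P Y - p * indicator (Ioi 1) (fun _ => 1) Y) / Y) =
      -∫ Y in Ioi Λ, (P Y - p * indicator (Ioi 1) (fun _ => 1) Y) / Y := by
    rw [hsplit, h1]; ring
  rw [this, abs_neg]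
  exact h2

lemma exists_integral_mul_thetaSum_bound (hcont : ContinuousOn P (Ioi 0))
    (hbdd : ∀ Y, |P Y| ≤ C') (hlin : ∀ Y, 0 < Y → |P Y| ≤ C' * Y) (hC : 0 ≤ C)
    (hsub : ∀ Y, 0 < Y → |P Y - p| ≤ C * Y ^ (-(1 / 2) : ℝ))
    (hint : IntegrableOn (fun Y => (P Y - p * indicator (Ioi 1) (fun _ => 1) Y) / Y) (Ioi 0)) :
    ∃ D, 0 ≤ D ∧ ∀ Λ, 1 ≤ Λ → |(∫ s in Ioi (0 : ℝ), P (Λ * s) * thetaSum (s ^ 2)) -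
      Real.sqrt Real.pi / 2 * (p * (Real.eulerMascheroniConstant / 2 - Real.log 2) +
        p * Real.log Λ +
        ∫ Y in Ioi (0 : ℝ), (P Y - p * indicator (Ioi 1) (fun _ => 1) Y) / Y)| ≤
      D * Λ ^ (-(1 / 2) : ℝ) := by
  refine ⟨C * (∫ s in Ioi (0 : ℝ), |s ^ (-(1 / 2) : ℝ) * regTheta (s ^ 2)|) +
    Real.sqrt Real.pi / 2 * (2 * C),
    add_nonneg (mul_nonneg hC (integral_nonneg fun _ => abs_nonneg _)) (by positivity),
    fun Λ hΛ => ?_⟩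
  have hΛ0 : 0 < Λ := by linarith
  set W := ∫ Y in Ioi (0 : ℝ), (P Y - p * indicator (Ioi 1) (fun _ => 1) Y) / Y with hW
  have hR : IntegrableOn (fun s : ℝ => regTheta (s ^ 2)) (Ioi 0) := by
    simpa using integrableOn_regTheta_sq (r := 0) (by norm_num)
  have hPm : ContinuousOn (fun s => P (Λ * s)) (Ioi 0) :=
    hcont.comp (by fun_prop) fun s hs => mul_pos hΛ0 hs
  have hA : IntegrableOn (fun s => P (Λ * s) * regTheta (s ^ 2)) (Ioi 0) :=
    hR.bdd_mul (hPm.aestronglyMeasurable measurableSet_Ioi)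
      (Eventually.of_forall fun s => hbdd (Λ * s))
  have hB : IntegrableOn (fun s => P (Λ * s) / s) (Ioc 0 1) := by
    refine integrableOn_div_self_Ioc (P := fun s => P (Λ * s)) (C' := C' * Λ) hPm
      (fun s hs => ?_) 1
    rw [mul_assoc]
    exact hlin _ (mul_pos hΛ0 hs)
  have hB' : IntegrableOn (indicator (Ioc 0 1) fun s => P (Λ * s) / s) (Ioi 0) :=
    ((integrable_indicator_iff measurableSet_Ioc).2 hB).integrableOn
  have hsplit : ∫ s in Ioi (0 : ℝ), P (Λ * s) * thetaSum (s ^ 2) =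
      (∫ s in Ioi (0 : ℝ), P (Λ * s) * regTheta (s ^ 2)) +
        Real.sqrt Real.pi / 2 * ∫ Y in Ioc 0 Λ, P Y / Y := by
    have h1 : ∫ Y in Ioc 0 Λ, P Y / Y = ∫ s in Ioc 0 1, P (Λ * s) / s := by
      have := intervalIntegral.integral_comp_mul_left (a := 0) (b := 1)
        (fun Y => P Y / Y) hΛ0.ne'
      rw [mul_zero, mul_one] at this
      rw [← intervalIntegral.integral_of_le hΛ0.le, ← intervalIntegral.integral_of_le zero_le_one,
        ← mul_inv_cancel_left₀ hΛ0.ne' (∫ Y in (0 : ℝ)..Λ, P Y / Y), ← smul_eq_mul Λ⁻¹, ← this,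
        ← intervalIntegral.integral_const_mul]
      congr 1
      funext s
      field_simp
    rw [h1, ← integral_const_mul, ← inter_eq_self_of_subset_right (Ioc_subset_Ioi_self :
      Ioc (0 : ℝ) 1 ⊆ Ioi 0), ← setIntegral_indicator measurableSet_Ioc, ← integral_add hA]
    · refine setIntegral_congr_fun measurableSet_Ioi fun s hs => ?_
      have hs0 : (0 : ℝ) < s := hs
      simp only [regTheta]
      by_cases h1 : s ≤ 1
      · have m1 : s ∈ Ioc (0 : ℝ) 1 := ⟨hs0, h1⟩
        have m2 : s ^ 2 ∈ Ioc (0 : ℝ) 1 := ⟨by positivity, pow_le_one₀ hs0.le h1⟩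
        rw [indicator_of_mem m1, indicator_of_mem m2, ← Real.rpow_natCast_mul hs0.le]
        norm_num
        rw [Real.rpow_neg_one]
        ring
      · have m1 : s ∉ Ioc (0 : ℝ) 1 := fun h => h1 h.2
        have m2 : s ^ 2 ∉ Ioc (0 : ℝ) 1 := fun h => h1 (by
          by_contra h3
          nlinarith [h.2, not_le.1 h3])
        rw [indicator_of_notMem m1, indicator_of_notMem m2]
        ring
    · have := hB'.const_mul (Real.sqrt Real.pi / 2)
      refine this.congr (Eventually.of_forall fun s => ?_)
      by_cases m1 : s ∈ Ioc (0 : ℝ) 1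
      · simp only [indicator_of_mem m1]
      · simp only [indicator_of_notMem m1, mul_zero]
  have hE1 : |(∫ s in Ioi (0 : ℝ), P (Λ * s) * regTheta (s ^ 2)) -
      p * ∫ s in Ioi (0 : ℝ), regTheta (s ^ 2)| ≤
      C * (∫ s in Ioi (0 : ℝ), |s ^ (-(1 / 2) : ℝ) * regTheta (s ^ 2)|) *
        Λ ^ (-(1 / 2) : ℝ) := by
    rw [← integral_const_mul, ← integral_sub hA (hR.const_mul p), mul_right_comm,
      ← integral_const_mul, ← Real.norm_eq_abs]
    refine norm_integral_le_of_norm_le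
      ((integrableOn_regTheta_sq (r := -(1 / 2)) (by norm_num)).abs.const_mul _) ?_
    filter_upwards [ae_restrict_mem measurableSet_Ioi] with s hs
    have hs0 : (0 : ℝ) < s := hs
    rw [← sub_mul, Real.norm_eq_abs, abs_mul, abs_mul,
      abs_of_pos (Real.rpow_pos_of_pos hs0 _), ← mul_assoc]
    gcongr
    refine (hsub _ (mul_pos hΛ0 hs0)).trans_eq ?_
    rw [Real.mul_rpow hΛ0.le hs0.le, mul_assoc]
  have hE2 := abs_integral_Ioc_div_self_sub_le hcont hlin hsub hint hΛ
  rw [← hW] at hE2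
  rw [hsplit]
  have hfin : (∫ s in Ioi (0 : ℝ), P (Λ * s) * regTheta (s ^ 2)) +
        Real.sqrt Real.pi / 2 * (∫ Y in Ioc 0 Λ, P Y / Y) -
      Real.sqrt Real.pi / 2 * (p * (Real.eulerMascheroniConstant / 2 - Real.log 2) +
        p * Real.log Λ + W) =
      ((∫ s in Ioi (0 : ℝ), P (Λ * s) * regTheta (s ^ 2)) -
        p * ∫ s in Ioi (0 : ℝ), regTheta (s ^ 2)) +
      Real.sqrt Real.pi / 2 * ((∫ Y in Ioc 0 Λ, P Y / Y) - (p * Real.log Λ + W)) := by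
    rw [integral_regTheta_sq]
    ring
  rw [hfin, add_mul]
  refine (abs_add_le _ _).trans (add_le_add hE1 ?_)
  rw [abs_mul, abs_of_nonneg (by positivity), mul_assoc]
  gcongr

end

section
open Filter Topology Asymptotics

lemma integrableOn_cube_mul_exp {b : ℝ} (hb : 0 < b) :
    IntegrableOn (fun τ : ℝ => (τ ^ 3)⁻¹ * Real.exp (-(b / τ ^ 2))) (Ioi 0) ∧
      ∫ τ in Ioi (0 : ℝ), (τ ^ 3)⁻¹ * Real.exp (-(b / τ ^ 2)) = 1 / (2 * b) := by
  have h1 := integrableOn_exp_mul_Ioi (a := -b) (by linarith) 0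
  have h2 := integral_exp_mul_Ioi (a := -b) (by linarith) 0
  have he : EqOn (fun x : ℝ => (|(-2 : ℝ)| * x ^ ((-2 : ℝ) - 1)) • Real.exp (-b * x ^ (-2 : ℝ)))
      (fun τ : ℝ => 2 * ((τ ^ 3)⁻¹ * Real.exp (-(b / τ ^ 2)))) (Ioi 0) := by
    intro x hx
    have hx0 : (0 : ℝ) ≤ x := le_of_lt hx
    have e1 : x ^ ((-2 : ℝ) - 1) = (x ^ 3)⁻¹ := by
      rw [show (-2 : ℝ) - 1 = -(3 : ℕ) by norm_num, Real.rpow_neg hx0, Real.rpow_natCast]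
    have e2 : x ^ (-2 : ℝ) = (x ^ 2)⁻¹ := by
      rw [show (-2 : ℝ) = -(2 : ℕ) by norm_num, Real.rpow_neg hx0, Real.rpow_natCast]
    simp only [e1, e2, abs_neg, abs_two, smul_eq_mul]
    rw [mul_assoc, neg_mul, ← div_eq_mul_inv]
  have h3 := (integrableOn_Ioi_comp_rpow_iff (fun x => Real.exp (-b * x))
    (p := -2) (by norm_num)).2 h1
  have h4 := integral_comp_rpow_Ioi (fun x => Real.exp (-b * x)) (p := -2) (by norm_num)
  rw [integrableOn_congr_fun he measurableSet_Ioi] at h3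
  rw [setIntegral_congr_fun measurableSet_Ioi he, h2, integral_const_mul] at h4
  refine ⟨?_, ?_⟩
  · have := h3.const_mul (1 / 2)
    simpa [IntegrableOn] using this
  · simp only [mul_zero, Real.exp_zero] at h4
    field_simp at h4 ⊢
    linarith

variable {P Q : ℝ → ℝ} {M C : ℝ}

lemma hasDerivAt_dil_mul_exp (hd : ∀ Y, 0 < Y → HasDerivAt P (Q Y / Y) Y) {b c τ : ℝ}
    (hc : 0 < c) (hτ : 0 < τ) :
    HasDerivAt (fun τ => P (c / τ) / τ ^ 2 * Real.exp (-(b / τ ^ 2)))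
      ((τ ^ 3)⁻¹ * Real.exp (-(b / τ ^ 2)) *
        (-Q (c / τ) - 2 * P (c / τ) + 2 * (b / τ ^ 2) * P (c / τ))) τ := by
  have h1 : HasDerivAt (fun τ => c / τ) (-(c / τ ^ 2)) τ := by
    convert! (hasDerivAt_inv hτ.ne').const_mul c using 1
    ring
  have h2 := (hd (c / τ) (div_pos hc hτ)).comp τ h1
  have h3 := hasDerivAt_pow 2 τ
  have h4 : HasDerivAt (fun τ => b / τ ^ 2) (-(2 * b / τ ^ 3)) τ := by
    convert! (h3.inv (by positivity)).const_mul b using 1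
    field_simp
    norm_num
    exact Or.inl (mul_comm _ _)
  have h5 := (h2.div h3 (by positivity)).mul h4.neg.exp
  convert! h5 using 1
  simp only [Function.comp_apply, Pi.div_apply, Pi.neg_apply]
  generalize Real.exp (-(b / τ ^ 2)) = E
  generalize P (c / τ) = p
  generalize Q (c / τ) = q
  have hτ' : τ ≠ 0 := hτ.ne'
  push_cast
  field_simp

lemma abs_tsum_dil_sub_integral_le (hd : ∀ Y, 0 < Y → HasDerivAt P (Q Y / Y) Y)
    (hP : ∀ Y, |P Y| ≤ M) (hQ : ∀ Y, |Q Y| ≤ M) (hlin : ∀ Y, 0 < Y → |P Y| ≤ C * Y)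
    {b c : ℝ} (hb : 0 < b) (hc : 0 < c) :
    |(∑' k : ℕ, P (c / (k + 1 : ℕ)) / ((k + 1 : ℕ) : ℝ) ^ 2 *
        Real.exp (-(b / ((k + 1 : ℕ) : ℝ) ^ 2))) -
      ∫ r in Ioi (0 : ℝ), P (c * r) * Real.exp (-(b * r ^ 2))| ≤ 4 * M / b := by
  have hd' := fun τ (hτ : 0 < τ) => hasDerivAt_dil_mul_exp (b := b) hd hc hτ
  have hφc : ContinuousOn (fun τ => P (c / τ) / τ ^ 2 * Real.exp (-(b / τ ^ 2))) (Ioi 0) :=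
    fun τ hτ => (hd' τ hτ).continuousAt.continuousWithinAt
  have hφ : IntegrableOn (fun τ => P (c / τ) / τ ^ 2 * Real.exp (-(b / τ ^ 2))) (Ioi 0) := by
    refine ((integrableOn_cube_mul_exp hb).1.const_mul (C * c)).mono'
      (hφc.aestronglyMeasurable measurableSet_Ioi) ?_
    filter_upwards [ae_restrict_mem measurableSet_Ioi] with τ hτ
    have hτ0 : 0 < τ := hτ
    rw [Real.norm_eq_abs, abs_mul, abs_of_pos (Real.exp_pos _), ← mul_assoc, abs_div,
      abs_of_pos (pow_pos hτ0 2)]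
    gcongr
    rw [div_le_iff₀ (by positivity)]
    refine (hlin _ (div_pos hc hτ0)).trans_eq ?_
    field_simp
  have hb2 : 0 < b / 2 := half_pos hb
  have hbound : ∀ τ, 0 < τ → |(τ ^ 3)⁻¹ * Real.exp (-(b / τ ^ 2)) *
        (-Q (c / τ) - 2 * P (c / τ) + 2 * (b / τ ^ 2) * P (c / τ))| ≤
      4 * M * ((τ ^ 3)⁻¹ * Real.exp (-(b / 2 / τ ^ 2))) := by
    intro τ hτ
    have hM : 0 ≤ M := (abs_nonneg _).trans (hP 0)
    set z := b / τ ^ 2 with hz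
    have hz0 : 0 < z := by positivity
    have e1 : b / 2 / τ ^ 2 = z / 2 := by rw [hz]; ring
    have e2 : |-Q (c / τ) - 2 * P (c / τ) + 2 * z * P (c / τ)| ≤ (3 + 2 * z) * M := by
      have q := abs_le.1 (hQ (c / τ))
      have q' := abs_le.1 (hP (c / τ))
      rw [abs_le]
      constructor <;> nlinarith
    have e3 : 3 + 2 * z ≤ 4 * Real.exp (z / 2) := by
      linarith [Real.add_one_le_exp (z / 2)]
    rw [abs_mul, abs_of_pos (by positivity), e1]
    have e4 : Real.exp (-(z / 2)) = Real.exp (-z) * Real.exp (z / 2) := by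
      rw [← Real.exp_add]; ring_nf
    rw [e4]
    calc (τ ^ 3)⁻¹ * Real.exp (-z) * |-Q (c / τ) - 2 * P (c / τ) + 2 * z * P (c / τ)|
        ≤ (τ ^ 3)⁻¹ * Real.exp (-z) * (4 * Real.exp (z / 2) * M) := by
          gcongr
          exact e2.trans (by gcongr)
      _ = _ := by ring
  have hi2 := (integrableOn_cube_mul_exp hb2).1.const_mul (4 * M)
  have hφ' : IntegrableOn (fun τ => (τ ^ 3)⁻¹ * Real.exp (-(b / τ ^ 2)) *
        (-Q (c / τ) - 2 * P (c / τ) + 2 * (b / τ ^ 2) * P (c / τ))) (Ioi 0) := by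
    refine hi2.mono' ?_ ?_
    · refine (measurable_deriv
        (fun τ => P (c / τ) / τ ^ 2 * Real.exp (-(b / τ ^ 2)))).aestronglyMeasurable.congr ?_
      filter_upwards [ae_restrict_mem measurableSet_Ioi] with τ hτ
      exact (hd' τ hτ).deriv
    · filter_upwards [ae_restrict_mem measurableSet_Ioi] with τ hτ
      exact hbound τ hτ
  have hsub : ∫ τ in Ioi (0 : ℝ), P (c / τ) / τ ^ 2 * Real.exp (-(b / τ ^ 2)) =
      ∫ r in Ioi (0 : ℝ), P (c * r) * Real.exp (-(b * r ^ 2)) := by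
    rw [← integral_comp_rpow_Ioi (fun r => P (c * r) * Real.exp (-(b * r ^ 2)))
      (p := -1) (by norm_num)]
    refine setIntegral_congr_fun measurableSet_Ioi fun τ hτ => ?_
    have hτ0 : (0 : ℝ) ≤ τ := le_of_lt hτ
    have e1 : τ ^ ((-1 : ℝ) - 1) = (τ ^ 2)⁻¹ := by
      rw [show (-1 : ℝ) - 1 = -(2 : ℕ) by norm_num, Real.rpow_neg hτ0, Real.rpow_natCast]
    simp only [e1, Real.rpow_neg_one, abs_neg, abs_one, one_mul, smul_eq_mul, inv_pow]
    simp only [div_eq_mul_inv]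
    ring
  rw [← hsub]
  refine (abs_tsum_sub_integral_le hd' hφ hφ').2.trans ?_
  refine (setIntegral_mono_on hφ'.abs hi2 measurableSet_Ioi hbound).trans_eq ?_
  rw [integral_const_mul, (integrableOn_cube_mul_exp hb2).2]
  field_simp

end

section
open Filter Topology Asymptotics

lemma exp_neg_le_inv {z : ℝ} (hz : 0 < z) : Real.exp (-z) ≤ z⁻¹ := by
  rw [Real.exp_neg]
  exact inv_anti₀ hz (by linarith [Real.add_one_le_exp z])

lemma summable_inv_succ_pow {j : ℕ} (hj : 2 ≤ j) :
    Summable fun n : ℕ => (((n + 1 : ℕ) : ℝ) ^ j)⁻¹ :=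
  (summable_nat_add_iff 1).2 (Real.summable_nat_pow_inv.2 hj)

lemma integrableOn_id_mul_gauss {a : ℝ} (ha : 0 < a) :
    IntegrableOn (fun s : ℝ => s * Real.exp (-(a * s ^ 2))) (Ioi 0) ∧
      ∫ s in Ioi (0 : ℝ), s * Real.exp (-(a * s ^ 2)) = 1 / (2 * a) := by
  have h1 := integrableOn_exp_mul_Ioi (a := -a) (by linarith) 0
  have h2 := integral_exp_mul_Ioi (a := -a) (by linarith) 0
  have he : EqOn (fun x : ℝ => (|(2 : ℝ)| * x ^ ((2 : ℝ) - 1)) • Real.exp (-a * x ^ (2 : ℝ)))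
      (fun s : ℝ => 2 * (s * Real.exp (-(a * s ^ 2)))) (Ioi 0) := by
    intro x hx
    simp only [show (2 : ℝ) - 1 = 1 by norm_num, Real.rpow_one, Real.rpow_two, abs_two,
      smul_eq_mul, neg_mul, mul_assoc]
  have h3 := (integrableOn_Ioi_comp_rpow_iff (fun x => Real.exp (-a * x))
    (p := 2) (by norm_num)).2 h1
  have h4 := integral_comp_rpow_Ioi (fun x => Real.exp (-a * x)) (p := 2) (by norm_num)
  rw [integrableOn_congr_fun he measurableSet_Ioi] at h3
  rw [setIntegral_congr_fun measurableSet_Ioi he, h2, integral_const_mul] at h4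
  refine ⟨?_, ?_⟩
  · have := h3.const_mul (1 / 2)
    simpa [IntegrableOn] using this
  · simp only [mul_zero, Real.exp_zero] at h4
    rw [show -(1 : ℝ) / -a = 2 * (1 / (2 * a)) by field_simp] at h4
    exact mul_left_cancel₀ two_ne_zero h4

variable {P Q : ℝ → ℝ} {M C C₂ : ℝ}

lemma summable_dil_mul_exp (hquad : ∀ Y, 0 < Y → |P Y| ≤ C₂ * Y ^ 2) {X : ℝ} (hX : 0 < X) :
    Summable fun q : ℕ × ℕ => P (X / (4 * Real.pi) / (q.1 + 1 : ℕ)) / ((q.1 + 1 : ℕ) : ℝ) ^ 2 *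
      Real.exp (-(X / (4 * ((q.1 + 1 : ℕ) : ℝ) ^ 2) * ((q.2 + 1 : ℕ) : ℝ) ^ 2)) := by
  have hs := ((summable_inv_succ_pow le_rfl).mul_of_nonneg (summable_inv_succ_pow le_rfl)
    (fun n => by positivity) (fun n => by positivity)).mul_left
      (C₂ * (X / (4 * Real.pi)) ^ 2 * (4 / X))
  refine hs.of_norm_bounded fun q => ?_
  have hpi := Real.pi_pos
  have hk : (0 : ℝ) < (q.1 + 1 : ℕ) := by positivity
  have hm : (0 : ℝ) < (q.2 + 1 : ℕ) := by positivity
  rw [Real.norm_eq_abs, abs_mul, abs_of_pos (Real.exp_pos _), abs_div, abs_of_pos (pow_pos hk 2)]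
  have hC : 0 ≤ C₂ := by simpa using (abs_nonneg _).trans (hquad 1 one_pos)
  calc _ ≤ C₂ * (X / (4 * Real.pi) / (q.1 + 1 : ℕ)) ^ 2 / ((q.1 + 1 : ℕ) : ℝ) ^ 2 *
        (X / (4 * ((q.1 + 1 : ℕ) : ℝ) ^ 2) * ((q.2 + 1 : ℕ) : ℝ) ^ 2)⁻¹ := by
        gcongr
        · exact hquad _ (by positivity)
        · exact exp_neg_le_inv (by positivity)
    _ = _ := by
        simp only [mul_inv]
        field_simp

lemma abs_tsum_dil_mul_thetaSum_sub_le (hd : ∀ Y, 0 < Y → HasDerivAt P (Q Y / Y) Y)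
    (hP : ∀ Y, |P Y| ≤ M) (hQ : ∀ Y, |Q Y| ≤ M) (hlin : ∀ Y, 0 < Y → |P Y| ≤ C * Y)
    (hquad : ∀ Y, 0 < Y → |P Y| ≤ C₂ * Y ^ 2) :
    ∃ D, 0 ≤ D ∧ ∀ X, 0 < X →
      |(∑' k : ℕ, P (X / (4 * Real.pi) / (k + 1 : ℕ)) / ((k + 1 : ℕ) : ℝ) ^ 2 *
          thetaSum (X / (4 * ((k + 1 : ℕ) : ℝ) ^ 2))) -
        2 / √X * ∫ s in Ioi (0 : ℝ), P (√X / (2 * Real.pi) * s) * thetaSum (s ^ 2)| ≤ D / X := by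
  have hM : 0 ≤ M := (abs_nonneg _).trans (hP 0)
  have hC : 0 ≤ C := by simpa using (abs_nonneg _).trans (hlin 1 one_pos)
  have hpi := Real.pi_pos
  refine ⟨16 * M * ∑' n : ℕ, (((n + 1 : ℕ) : ℝ) ^ 2)⁻¹,
    mul_nonneg (by positivity) (tsum_nonneg fun n => by positivity), fun X hX => ?_⟩
  have hsX : 0 < √X := Real.sqrt_pos.2 hX
  have hs := summable_dil_mul_exp hquad hX
  set Λ := √X / (2 * Real.pi) with hΛ
  have hΛ0 : 0 < Λ := by positivity
  have hcP : ContinuousOn (fun s => P (Λ * s)) (Ioi 0) := by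
    refine ContinuousOn.comp (t := Ioi 0) (g := P)
      (fun Y hY => (hd Y hY).continuousAt.continuousWithinAt) (by fun_prop) ?_
    intro s hs
    exact mul_pos hΛ0 hs
  have e1 : (∑' k : ℕ, P (X / (4 * Real.pi) / (k + 1 : ℕ)) / ((k + 1 : ℕ) : ℝ) ^ 2 *
          thetaSum (X / (4 * ((k + 1 : ℕ) : ℝ) ^ 2))) =
      ∑' m : ℕ, ∑' k : ℕ, P (X / (4 * Real.pi) / (k + 1 : ℕ)) / ((k + 1 : ℕ) : ℝ) ^ 2 *
        Real.exp (-(X / (4 * ((k + 1 : ℕ) : ℝ) ^ 2) * ((m + 1 : ℕ) : ℝ) ^ 2)) := by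
    rw [Summable.tsum_comm (f := fun k m : ℕ => P (X / (4 * Real.pi) / (k + 1 : ℕ)) /
      ((k + 1 : ℕ) : ℝ) ^ 2 * Real.exp (-(X / (4 * ((k + 1 : ℕ) : ℝ) ^ 2) *
        ((m + 1 : ℕ) : ℝ) ^ 2))) hs]
    refine tsum_congr fun k => ?_
    rw [thetaSum, ← tsum_mul_left]
  have hnorm : ∀ (m : ℕ) (s : ℝ), s ∈ Ioi (0 : ℝ) →
      ‖P (Λ * s) * Real.exp (-(s ^ 2 * ((m + 1 : ℕ) : ℝ) ^ 2))‖ ≤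
        C * Λ * (s * Real.exp (-(((m + 1 : ℕ) : ℝ) ^ 2 * s ^ 2))) := by
    intro m s hs
    rw [Real.norm_eq_abs, abs_mul, abs_of_pos (Real.exp_pos _), mul_comm (s ^ 2), ← mul_assoc,
      mul_assoc C]
    gcongr
    exact hlin _ (mul_pos hΛ0 hs)
  have hint : ∀ m : ℕ, IntegrableOn
      (fun s => P (Λ * s) * Real.exp (-(s ^ 2 * ((m + 1 : ℕ) : ℝ) ^ 2))) (Ioi 0) := by
    intro m
    refine ((integrableOn_id_mul_gauss (a := ((m + 1 : ℕ) : ℝ) ^ 2)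
      (by positivity)).1.const_mul (C * Λ)).mono' ?_ ?_
    · exact (hcP.mul (by fun_prop)).aestronglyMeasurable measurableSet_Ioi
    · filter_upwards [ae_restrict_mem measurableSet_Ioi] with s hs using hnorm m s hs
  have hsumn : Summable fun m : ℕ => ∫ s in Ioi (0 : ℝ),
      ‖P (Λ * s) * Real.exp (-(s ^ 2 * ((m + 1 : ℕ) : ℝ) ^ 2))‖ := by
    refine ((summable_inv_succ_pow le_rfl).mul_left (C * Λ / 2)).of_nonneg_of_le
      (fun m => by positivity) fun m => ?_
    have hg := integrableOn_id_mul_gauss (a := ((m + 1 : ℕ) : ℝ) ^ 2) (by positivity)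
    refine (setIntegral_mono_on (hint m).norm (hg.1.const_mul (C * Λ)) measurableSet_Ioi
      (hnorm m)).trans_eq ?_
    rw [integral_const_mul, hg.2]
    ring
  have e2 := hasSum_integral_of_summable_integral_norm hint hsumn
  have e3 : (∫ s in Ioi (0 : ℝ), P (Λ * s) * thetaSum (s ^ 2)) =
      ∫ s in Ioi (0 : ℝ), ∑' m : ℕ, P (Λ * s) * Real.exp (-(s ^ 2 * ((m + 1 : ℕ) : ℝ) ^ 2)) := by
    refine setIntegral_congr_fun measurableSet_Ioi fun s _ => ?_
    simp only [thetaSum, tsum_mul_left]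
  have e4 := e2.mul_left (2 / √X)
  rw [← e3] at e4
  have e5 : Summable fun m : ℕ => ∑' k : ℕ, P (X / (4 * Real.pi) / (k + 1 : ℕ)) /
      ((k + 1 : ℕ) : ℝ) ^ 2 * Real.exp (-(X / (4 * ((k + 1 : ℕ) : ℝ) ^ 2) *
        ((m + 1 : ℕ) : ℝ) ^ 2)) := hs.prod_symm.prod
  rw [e1, ← e4.tsum_eq, ← e5.tsum_sub e4.summable]
  have e6 := (summable_inv_succ_pow le_rfl).hasSum.mul_left (16 * M / X)
  rw [show 16 * M * (∑' n : ℕ, (((n + 1 : ℕ) : ℝ) ^ 2)⁻¹) / X =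
    16 * M / X * ∑' n : ℕ, (((n + 1 : ℕ) : ℝ) ^ 2)⁻¹ by ring]
  rw [← Real.norm_eq_abs]
  refine tsum_of_norm_bounded e6 fun m => ?_
  have hm : (0 : ℝ) < (m + 1 : ℕ) := by positivity
  have key := abs_tsum_dil_sub_integral_le hd hP hQ hlin
    (b := X * ((m + 1 : ℕ) : ℝ) ^ 2 / 4) (c := X / (4 * Real.pi)) (by positivity) (by positivity)
  have e7 : (∫ r in Ioi (0 : ℝ), P (X / (4 * Real.pi) * r) *
      Real.exp (-(X * ((m + 1 : ℕ) : ℝ) ^ 2 / 4 * r ^ 2))) =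
      2 / √X * ∫ s in Ioi (0 : ℝ), P (Λ * s) * Real.exp (-(s ^ 2 * ((m + 1 : ℕ) : ℝ) ^ 2)) := by
    have := integral_comp_mul_left_Ioi (fun s => P (Λ * s) *
      Real.exp (-(s ^ 2 * ((m + 1 : ℕ) : ℝ) ^ 2))) 0 (b := √X / 2) (by positivity)
    rw [mul_zero, inv_div, smul_eq_mul] at this
    rw [← this]
    refine setIntegral_congr_fun measurableSet_Ioi fun r _ => ?_
    have hq : X = √X ^ 2 := (Real.sq_sqrt hX.le).symm
    have a1 : X / (4 * Real.pi) * r = Λ * (√X / 2 * r) := by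
      rw [hΛ]; nth_rewrite 1 [hq]; ring
    have a2 : X * ((m + 1 : ℕ) : ℝ) ^ 2 / 4 * r ^ 2 = (√X / 2 * r) ^ 2 * ((m + 1 : ℕ) : ℝ) ^ 2 := by
      nth_rewrite 1 [hq]; ring
    simp only [a1, a2]
  rw [e7] at key
  have e8 : 4 * M / (X * ((m + 1 : ℕ) : ℝ) ^ 2 / 4) = 16 * M / X * (((m + 1 : ℕ) : ℝ) ^ 2)⁻¹ := by
    field_simp
    ring
  rw [e8] at key
  rw [Real.norm_eq_abs]
  convert! key using 6
  ring_nf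

end

section
open Filter Topology Asymptotics

/-- The kernel obtained by summing the diagonal terms over all quadruples at a fixed point. -/
noncomputable def diagKer (ψ₁ ψ₂ : ℝ → ℝ) (X : ℝ) : ℝ :=
  ∑' k : ℕ, dilProd ψ₁ ψ₂ (X / (4 * Real.pi) / (k + 1 : ℕ)) / ((k + 1 : ℕ) : ℝ) ^ 2 *
    thetaSum (X / (4 * ((k + 1 : ℕ) : ℝ) ^ 2))

variable {ψ₁ ψ₂ : ℝ → ℝ}

lemma exists_dilProd_le_sq (h₁ : IsCutoff ψ₁) (h₂ : IsCutoff ψ₂) :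
    ∃ C, 0 ≤ C ∧ ∀ Y, 0 < Y → |dilProd ψ₁ ψ₂ Y| ≤ C * Y ^ 2 := by
  obtain ⟨C₁, hC₁, H₁⟩ := h₁.exists_dilSum_le_mul
  obtain ⟨C₂, hC₂, H₂⟩ := h₂.exists_dilSum_le_mul
  refine ⟨C₁ * C₂, by positivity, fun Y hY => ?_⟩
  rw [dilProd, abs_mul]
  calc _ ≤ (C₁ * Y) * (C₂ * Y) := by
        gcongr
        exacts [H₁ Y hY, H₂ Y hY]
    _ = _ := by ring

lemma exists_dilProd_deriv (h₁ : IsCutoff ψ₁) (h₂ : IsCutoff ψ₂) :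
    ∃ (Q : ℝ → ℝ) (M : ℝ), (∀ Y, 0 < Y → HasDerivAt (dilProd ψ₁ ψ₂) (Q Y / Y) Y) ∧
      ∀ Y, |Q Y| ≤ M := by
  obtain ⟨C₁, hC₁, H₁⟩ := h₁.exists_dilSum_bounded
  obtain ⟨C₂, hC₂, H₂⟩ := h₂.exists_dilSum_bounded
  obtain ⟨D₁, hD₁, H₁'⟩ := h₁.exists_dilSum_mul_deriv_bound
  obtain ⟨D₂, hD₂, H₂'⟩ := h₂.exists_dilSum_mul_deriv_bound
  refine ⟨fun Y => dilSum (fun y => y * deriv ψ₁ y) Y * dilSum ψ₂ Y +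
    dilSum ψ₁ Y * dilSum (fun y => y * deriv ψ₂ y) Y, D₁ * C₂ + C₁ * D₂, fun Y hY => ?_,
    fun Y => ?_⟩
  · have e₁ := hasDerivAt_dilSum (h₁.smooth.of_le (by simp)) h₁.compact h₁.pos hY
    have e₂ := hasDerivAt_dilSum (h₂.smooth.of_le (by simp)) h₂.compact h₂.pos hY
    convert! e₁.mul e₂ using 1
    ring
  · refine (abs_add_le _ _).trans ?_
    rw [abs_mul, abs_mul]
    gcongr
    exacts [H₁' Y, H₂ Y, H₁ Y, H₂' Y]

lemma exists_diagKer_bound (h₁ : IsCutoff ψ₁) (h₂ : IsCutoff ψ₂) :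
    ∃ D, 0 ≤ D ∧ ∀ X, 4 * Real.pi ^ 2 ≤ X →
      |diagKer ψ₁ ψ₂ X - (√Real.pi / 2 * (logMass ψ₁ * logMass ψ₂) * Real.log X +
        √Real.pi * ((Real.eulerMascheroniConstant / 2 - Real.log (4 * Real.pi)) *
          (logMass ψ₁ * logMass ψ₂) + regMass ψ₁ ψ₂)) * X ^ (-(1 / 2) : ℝ)| ≤
        D * X ^ (-(3 / 4) : ℝ) := by
  obtain ⟨Q, M, hd, hQ⟩ := exists_dilProd_deriv h₁ h₂
  obtain ⟨M', hM', hP⟩ := exists_dilProd_bounded h₁ h₂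
  obtain ⟨C, hC, hlin⟩ := exists_dilProd_le_mul h₁ h₂
  obtain ⟨C₂, hC₂, hquad⟩ := exists_dilProd_le_sq h₁ h₂
  obtain ⟨C₃, hC₃, hsub⟩ := exists_dilProd_sub_le h₁ h₂
  obtain ⟨D₁, hD₁, H₁⟩ := abs_tsum_dil_mul_thetaSum_sub_le (M := max M M') hd
    (fun Y => (hP Y).trans (le_max_right _ _)) (fun Y => (hQ Y).trans (le_max_left _ _)) hlin hquad
  obtain ⟨D₂, hD₂, H₂⟩ := exists_integral_mul_thetaSum_bound (C' := max M' C)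
    (continuousOn_dilProd h₁ h₂) (fun Y => (hP Y).trans (le_max_left _ _))
    (fun Y hY => (hlin Y hY).trans (by gcongr; exact le_max_right _ _)) hC₃ hsub
    (regMass_aux h₁ h₂).1
  have hpi := Real.pi_pos
  refine ⟨D₁ + 2 * D₂ * (2 * Real.pi) ^ (1 / 2 : ℝ), by positivity, fun X hX => ?_⟩
  have hX1 : 1 ≤ X := by nlinarith [Real.pi_gt_three]
  have hX0 : 0 < X := by linarith
  have hsX : 0 < √X := Real.sqrt_pos.2 hX0
  have a1 := H₁ X hX0
  have hL : 1 ≤ √X / (2 * Real.pi) := by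
    rw [le_div_iff₀ (by positivity), one_mul]
    apply Real.le_sqrt_of_sq_le
    linarith
  have a2 := H₂ _ hL
  have hlog : Real.log (√X / (2 * Real.pi)) = Real.log X / 2 - Real.log (2 * Real.pi) := by
    rw [Real.log_div hsX.ne' (by positivity), Real.log_sqrt hX0.le]
  have hlog2 : Real.log (4 * Real.pi) = Real.log 2 + Real.log (2 * Real.pi) := by
    rw [← Real.log_mul (by norm_num) (by positivity)]
    ring_nf
  have hs : X ^ (-(1 / 2) : ℝ) = 1 / √X := by
    rw [Real.rpow_neg hX0.le, ← Real.sqrt_eq_rpow, one_div]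
  have hL2 : (√X / (2 * Real.pi)) ^ (-(1 / 2) : ℝ) =
      (2 * Real.pi) ^ (1 / 2 : ℝ) * X ^ (-(1 / 4) : ℝ) := by
    rw [Real.div_rpow hsX.le (by positivity), Real.sqrt_eq_rpow, ← Real.rpow_mul hX0.le,
      Real.rpow_neg (x := 2 * Real.pi) (by positivity), div_inv_eq_mul, mul_comm]
    norm_num
  have h34 : X ^ (-(3 / 4) : ℝ) = 1 / √X * X ^ (-(1 / 4) : ℝ) := by
    rw [← hs, ← Real.rpow_add hX0]
    norm_num
  have h1X : 1 / X ≤ X ^ (-(3 / 4) : ℝ) := by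
    rw [one_div, ← Real.rpow_neg_one]
    exact Real.rpow_le_rpow_of_exponent_le hX1 (by norm_num)
  rw [hlog, hL2, ← regMass] at a2
  rw [hlog2, hs]
  set I := ∫ s in Ioi (0 : ℝ), dilProd ψ₁ ψ₂ (√X / (2 * Real.pi) * s) * thetaSum (s ^ 2)
  set p := logMass ψ₁ * logMass ψ₂
  set W := regMass ψ₁ ψ₂
  have a3 : |2 / √X * I - (√Real.pi / 2 * p * Real.log X +
      √Real.pi * ((Real.eulerMascheroniConstant / 2 - (Real.log 2 + Real.log (2 * Real.pi))) * p +
        W)) * (1 / √X)| ≤ 2 * D₂ * (2 * Real.pi) ^ (1 / 2 : ℝ) * X ^ (-(3 / 4) : ℝ) := by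
    rw [h34]
    have := mul_le_mul_of_nonneg_left a2 (a := 2 / √X) (by positivity)
    rw [← abs_of_pos (show 0 < 2 / √X by positivity), ← abs_mul,
      abs_of_pos (show 0 < 2 / √X by positivity)] at this
    refine (le_of_eq ?_).trans (this.trans_eq ?_)
    · congr 1
      ring
    · ring
  calc _ ≤ |diagKer ψ₁ ψ₂ X - 2 / √X * I| + _ := abs_sub_le _ _ _
    _ ≤ D₁ * X ^ (-(3 / 4) : ℝ) +
        2 * D₂ * (2 * Real.pi) ^ (1 / 2 : ℝ) * X ^ (-(3 / 4) : ℝ) := by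
        refine add_le_add (a1.trans ?_) a3
        rw [div_eq_mul_one_div]
        gcongr
    _ = _ := by ring

end

section
open Filter Topology Asymptotics

/-- The summand of the diagonal sum indexed by `q = (n, d₁, d₂, m)`. -/
noncomputable def quadTerm (ψ₁ ψ₂ : ℝ → ℝ) (X : ℝ) (q : ℕ+ × ℕ+ × ℕ+ × ℕ+) : ℝ :=
  1 / ((q.2.1 : ℝ) * (q.2.2.1 : ℝ) * (q.1 : ℝ) ^ 2) *
    (ψ₁ (X / (4 * Real.pi * (q.1 : ℝ) * (q.2.1 : ℝ))) *
      ψ₂ (X / (4 * Real.pi * (q.1 : ℝ) * (q.2.2.1 : ℝ))) *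
      Real.exp (-(X * (q.2.2.2 : ℝ) ^ 2 / (4 * (q.1 : ℝ) ^ 2))))

/-- A summable majorant of `quadTerm`, up to a factor depending on `X` alone. -/
noncomputable def quadWeight (q : ℕ+ × ℕ+ × ℕ+ × ℕ+) : ℝ :=
  ((q.1 : ℝ) ^ 4)⁻¹ * (((q.2.1 : ℝ) ^ 3)⁻¹ * (((q.2.2.1 : ℝ) ^ 3)⁻¹ * ((q.2.2.2 : ℝ) ^ 2)⁻¹))

lemma quadWeight_nonneg (q : ℕ+ × ℕ+ × ℕ+ × ℕ+) : 0 ≤ quadWeight q := by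
  rw [quadWeight]; positivity

lemma summable_inv_pnat_pow {j : ℕ} (hj : 2 ≤ j) : Summable fun n : ℕ+ => ((n : ℝ) ^ j)⁻¹ :=
  (summable_pnat_iff_summable_succ (f := fun n : ℕ => ((n : ℝ) ^ j)⁻¹)).2
    (summable_inv_succ_pow hj)

lemma summable_quadWeight : Summable quadWeight := by
  have h3 := summable_inv_pnat_pow (j := 3) (by norm_num)
  have h2 := summable_inv_pnat_pow (j := 2) le_rfl
  have h4 := summable_inv_pnat_pow (j := 4) (by norm_num)
  have a := h3.mul_of_nonneg h2 (fun _ => by positivity) (fun _ => by positivity)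
  have b := h3.mul_of_nonneg a (fun _ => by positivity) (fun _ => by positivity)
  exact h4.mul_of_nonneg b (fun _ => by positivity) (fun _ => by positivity)

variable {ψ ψ₁ ψ₂ : ℝ → ℝ}

lemma IsCutoff.exists_le_sq (h : IsCutoff ψ) : ∃ C, 0 ≤ C ∧ ∀ Y, 0 < Y → |ψ Y| ≤ C * Y ^ 2 := by
  obtain ⟨M, -, hM⟩ := exists_abs_bound h.continuous h.compact
  obtain ⟨a, b, ha, hab, hs⟩ := exists_support_bounds h.compact h.pos
  have hM0 : 0 ≤ M := (abs_nonneg _).trans (hM 0)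
  refine ⟨M / a ^ 2, by positivity, fun Y hY => ?_⟩
  by_cases h0 : ψ Y = 0
  · rw [h0, abs_zero]; positivity
  · have := (hs Y h0).1
    refine (hM Y).trans ?_
    rw [div_mul_eq_mul_div, le_div_iff₀ (by positivity)]
    gcongr

lemma exists_quadTerm_bound (h₁ : IsCutoff ψ₁) (h₂ : IsCutoff ψ₂) :
    ∃ C, 0 ≤ C ∧ ∀ X, 0 < X → ∀ q, |quadTerm ψ₁ ψ₂ X q| ≤ C * X ^ 3 * quadWeight q := by
  obtain ⟨C₁, hC₁, H₁⟩ := h₁.exists_le_sq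
  obtain ⟨C₂, hC₂, H₂⟩ := h₂.exists_le_sq
  have hpi := Real.pi_pos
  refine ⟨C₁ * C₂ * 4 / (4 * Real.pi) ^ 4, by positivity, fun X hX q => ?_⟩
  obtain ⟨n, d₁, d₂, m⟩ := q
  simp only [quadTerm, quadWeight]
  have hn : (0 : ℝ) < n := by exact_mod_cast n.pos
  have hd₁ : (0 : ℝ) < d₁ := by exact_mod_cast d₁.pos
  have hd₂ : (0 : ℝ) < d₂ := by exact_mod_cast d₂.pos
  have hm : (0 : ℝ) < m := by exact_mod_cast m.pos
  rw [abs_mul, abs_mul, abs_mul, abs_of_pos (Real.exp_pos _), abs_of_pos (by positivity)]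
  calc _ ≤ 1 / ((d₁ : ℝ) * (d₂ : ℝ) * (n : ℝ) ^ 2) *
        (C₁ * (X / (4 * Real.pi * n * d₁)) ^ 2 * (C₂ * (X / (4 * Real.pi * n * d₂)) ^ 2) *
          (X * (m : ℝ) ^ 2 / (4 * (n : ℝ) ^ 2))⁻¹) := by
        gcongr
        · exact H₁ _ (by positivity)
        · exact H₂ _ (by positivity)
        · exact exp_neg_le_inv (by positivity)
    _ = _ := by
        field_simp

lemma dilSum_eq_tsum_pnat (ψ : ℝ → ℝ) (Y : ℝ) :
    dilSum ψ Y = ∑' d : ℕ+, ψ (Y / (d : ℝ)) / (d : ℝ) := by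
  refine (Function.Injective.tsum_eq (f := fun d : ℕ => ψ (Y / d) / d)
    PNat.coe_injective fun d hd => ?_).symm
  rcases Nat.eq_zero_or_pos d with rfl | h
  · simp at hd
  · exact ⟨⟨d, h⟩, rfl⟩

lemma summable_quadTerm (h₁ : IsCutoff ψ₁) (h₂ : IsCutoff ψ₂) {X : ℝ} (hX : 0 < X) :
    Summable (quadTerm ψ₁ ψ₂ X) := by
  obtain ⟨C, hC, H⟩ := exists_quadTerm_bound h₁ h₂
  exact (summable_quadWeight.mul_left (C * X ^ 3)).of_norm_bounded (H X hX)

lemma tsum_quadTerm (h₁ : IsCutoff ψ₁) (h₂ : IsCutoff ψ₂) {X : ℝ} (hX : 0 < X) :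
    ∑' q, quadTerm ψ₁ ψ₂ X q = diagKer ψ₁ ψ₂ X := by
  have hs := summable_quadTerm h₁ h₂ hX
  rw [hs.tsum_prod, diagKer, ← tsum_pnat_eq_tsum_succ (f := fun n : ℕ =>
    dilProd ψ₁ ψ₂ (X / (4 * Real.pi) / (n : ℕ)) / (n : ℝ) ^ 2 * thetaSum (X / (4 * (n : ℝ) ^ 2)))]
  refine tsum_congr fun n => ?_
  have hsn := hs.prod_factor n
  rw [hsn.tsum_prod]
  have key : ∀ d₁ : ℕ+, ∑' r : ℕ+ × ℕ+, quadTerm ψ₁ ψ₂ X (n, d₁, r) =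
      ψ₁ (X / (4 * Real.pi) / (n : ℝ) / (d₁ : ℝ)) / (d₁ : ℝ) *
        (dilSum ψ₂ (X / (4 * Real.pi) / (n : ℝ)) *
          (1 / (n : ℝ) ^ 2 * thetaSum (X / (4 * (n : ℝ) ^ 2)))) := by
    intro d₁
    rw [(hsn.prod_factor d₁).tsum_prod, dilSum_eq_tsum_pnat, ← tsum_mul_right, ← tsum_mul_left]
    refine tsum_congr fun d₂ => ?_
    rw [thetaSum, ← tsum_pnat_eq_tsum_succ (f := fun m : ℕ =>
      Real.exp (-(X / (4 * (n : ℝ) ^ 2) * (m : ℝ) ^ 2)))]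
    simp only [← tsum_mul_left]
    refine tsum_congr fun m => ?_
    rw [quadTerm]
    have e1 : X / (4 * Real.pi * (n : ℝ) * (d₁ : ℝ)) = X / (4 * Real.pi) / n / d₁ := by
      simp only [div_div]
    have e2 : X / (4 * Real.pi * (n : ℝ) * (d₂ : ℝ)) = X / (4 * Real.pi) / n / d₂ := by
      simp only [div_div]
    have e3 : X * (m : ℝ) ^ 2 / (4 * (n : ℝ) ^ 2) = X / (4 * (n : ℝ) ^ 2) * (m : ℝ) ^ 2 := by ring
    simp only [e1, e2, e3]
    field_simp
  simp only [key, tsum_mul_right, ← dilSum_eq_tsum_pnat, dilProd]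
  ring

end

section
open Filter Topology Asymptotics

variable {h ψ₁ ψ₂ : ℝ → ℝ}

lemma continuous_quadTerm (h₁ : IsCutoff ψ₁) (h₂ : IsCutoff ψ₂) (q : ℕ+ × ℕ+ × ℕ+ × ℕ+) :
    Continuous fun X => quadTerm ψ₁ ψ₂ X q := by
  have c₁ := h₁.continuous
  have c₂ := h₂.continuous
  unfold quadTerm
  fun_prop

lemma continuousOn_diagKer (h₁ : IsCutoff ψ₁) (h₂ : IsCutoff ψ₂) :
    ContinuousOn (diagKer ψ₁ ψ₂) (Ioi 0) := by
  obtain ⟨C, hC, H⟩ := exists_quadTerm_bound h₁ h₂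
  refine ContinuousOn.congr (f := fun X => ∑' q, quadTerm ψ₁ ψ₂ X q) ?_
    fun X hX => (tsum_quadTerm h₁ h₂ hX).symm
  intro X hX
  have hX0 : (0 : ℝ) < X := hX
  have := continuousOn_tsum (s := Ioo 0 (X + 1)) (f := fun q X => quadTerm ψ₁ ψ₂ X q)
    (fun q => (continuous_quadTerm h₁ h₂ q).continuousOn)
    (summable_quadWeight.mul_left (C * (X + 1) ^ 3)) fun q x hx => by
      refine (H x hx.1 q).trans ?_
      have := quadWeight_nonneg q
      have hx0 := hx.1.le
      have hx1 := hx.2.le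
      gcongr
  exact (this.continuousAt (Ioo_mem_nhds hX0 (by linarith))).continuousWithinAt

lemma integral_comp_sqrt_Ioi (F : ℝ → ℝ) :
    ∫ u in Ioi (0 : ℝ), F (√u) = ∫ x in Ioi (0 : ℝ), 2 * x * F x := by
  rw [← integral_comp_rpow_Ioi_of_pos (g := fun u => F (√u)) (p := 2) two_pos]
  refine setIntegral_congr_fun measurableSet_Ioi fun x hx => ?_
  have hx0 : (0 : ℝ) ≤ x := le_of_lt hx
  simp only [show (2 : ℝ) - 1 = 1 by norm_num, Real.rpow_one, Real.rpow_two, Real.sqrt_sq hx0,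
    smul_eq_mul]

lemma integral_eq_Ihint (h : ℝ → ℝ) :
    ∫ v in Ioi (0 : ℝ), h v = √(Real.pi / 2) * Ihint h := by
  have hpi := Real.pi_pos
  have e : Ihint h = ∫ u in Ioi (0 : ℝ), h (√u) / (√(2 * Real.pi) * √u) := by
    refine setIntegral_congr_fun measurableSet_Ioi fun u hu => ?_
    simp only [Real.sqrt_mul (show (0 : ℝ) ≤ 2 * Real.pi by positivity)]
  rw [e, integral_comp_sqrt_Ioi (fun x => h x / (√(2 * Real.pi) * x)), ← integral_const_mul]
  refine setIntegral_congr_fun measurableSet_Ioi fun x hx => ?_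
  have hx0 : (0 : ℝ) < x := hx
  have h2 : √(Real.pi / 2) * 2 = √(2 * Real.pi) := by
    rw [← Real.sqrt_sq (show (0 : ℝ) ≤ 2 by norm_num), ← Real.sqrt_mul (by positivity),
      Real.sqrt_sq (show (0 : ℝ) ≤ 2 by norm_num)]
    ring_nf
  have h3 : √(2 * Real.pi) ≠ 0 := (Real.sqrt_pos.2 (by positivity)).ne'
  have : √(Real.pi / 2) * (2 * x * (h x / (√(2 * Real.pi) * x))) =
      (√(Real.pi / 2) * 2) * h x / √(2 * Real.pi) := by
    field_simp
  simp only [this, h2]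
  field_simp

lemma diagTerm_eq (hh : Continuous h) (hhc : HasCompactSupport h) (hhs : tsupport h ⊆ Ioi 0)
    (h₁ : IsCutoff ψ₁) (h₂ : IsCutoff ψ₂) {θ K : ℝ} (hK : 0 < K) :
    diagTerm h ψ₁ ψ₂ θ K = K ^ θ / 8 *
      ∫ v in Ioi (0 : ℝ), h v * ((K + v * K ^ θ) * diagKer ψ₁ ψ₂ (K + v * K ^ θ)) := by
  obtain ⟨a, b, ha, hab, hs⟩ := exists_support_bounds hhc hhs
  obtain ⟨C, hC, H⟩ := exists_quadTerm_bound h₁ h₂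
  have hG : 0 < K ^ θ := Real.rpow_pos_of_pos hK θ
  set G := K ^ θ with hGdef
  set L := K / G with hL
  have hL0 : 0 < L := by positivity
  have hpi := Real.pi_pos
  have h2pi : 0 < √(2 * Real.pi) := Real.sqrt_pos.2 (by positivity)
  have hz : ∀ v ≤ 0, h v = 0 := fun v hv => by
    by_contra hne
    linarith [(hs v hne).1]
  have hwint : Integrable fun u : ℝ => |h (√u - L)| * (√u) ^ 3 := by
    refine Continuous.integrable_of_hasCompactSupport (by fun_prop) ?_
    refine HasCompactSupport.intro (isCompact_Icc (a := 0) (b := (L + b) ^ 2)) fun u hu => ?_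
    by_contra hne
    have hne' : h (√u - L) ≠ 0 := fun h0 => hne (by simp [h0])
    have := hs _ hne'
    refine hu ⟨?_, ?_⟩
    · by_contra hu0
      rw [Real.sqrt_eq_zero_of_nonpos (by linarith)] at this
      linarith
    · rw [← Real.sqrt_le_left (by linarith)]
      linarith
  have hnorm : ∀ q : ℕ+ × ℕ+ × ℕ+ × ℕ+, ∀ u ∈ Ioi (0 : ℝ),
      ‖h (√u - L) * quadTerm ψ₁ ψ₂ (√u * G) q‖ ≤
        C * G ^ 3 * quadWeight q * (|h (√u - L)| * (√u) ^ 3) := by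
    intro q u hu
    rw [norm_mul, Real.norm_eq_abs, Real.norm_eq_abs]
    refine (mul_le_mul_of_nonneg_left (H (√u * G) (mul_pos (Real.sqrt_pos.2 hu) hG) q)
      (abs_nonneg _)).trans_eq ?_
    ring
  have hint : ∀ q : ℕ+ × ℕ+ × ℕ+ × ℕ+,
      IntegrableOn (fun u => h (√u - L) * quadTerm ψ₁ ψ₂ (√u * G) q) (Ioi 0) := by
    intro q
    refine (hwint.integrableOn.const_mul (C * G ^ 3 * quadWeight q)).mono' ?_ ?_
    · have := continuous_quadTerm h₁ h₂ q
      have c : Continuous fun u => h (√u - L) * quadTerm ψ₁ ψ₂ (√u * G) q :=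
        (hh.comp (by fun_prop)).mul (this.comp (by fun_prop))
      exact c.aestronglyMeasurable
    · filter_upwards [ae_restrict_mem measurableSet_Ioi] with u hu using hnorm q u hu
  have hsum : Summable fun q : ℕ+ × ℕ+ × ℕ+ × ℕ+ => ∫ u in Ioi (0 : ℝ),
      ‖h (√u - L) * quadTerm ψ₁ ψ₂ (√u * G) q‖ := by
    refine (summable_quadWeight.mul_left
      (C * G ^ 3 * ∫ u in Ioi (0 : ℝ), |h (√u - L)| * (√u) ^ 3)).of_nonneg_of_le
      (fun q => by positivity) fun q => ?_
    refine (setIntegral_mono_on (hint q).norm (hwint.integrableOn.const_mul _) measurableSet_Ioi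
      (hnorm q)).trans_eq ?_
    rw [integral_const_mul]
    ring
  have e1 := (hasSum_integral_of_summable_integral_norm hint hsum).tsum_eq
  have e2 : ∑' q : ℕ+ × ℕ+ × ℕ+ × ℕ+, (1 / ((q.2.1 : ℝ) * (q.2.2.1 : ℝ) * (q.1 : ℝ) ^ 2)) *
        ∫ u in Ioi (0 : ℝ),
          h (√u - L) * √u / √(2 * Real.pi * u) *
            ψ₁ (√u * G / (4 * Real.pi * (q.1 : ℝ) * (q.2.1 : ℝ))) *
            ψ₂ (√u * G / (4 * Real.pi * (q.1 : ℝ) * (q.2.2.1 : ℝ))) *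
            Real.exp (-(√u * G * (q.2.2.2 : ℝ) ^ 2 / (4 * (q.1 : ℝ) ^ 2))) =
      1 / √(2 * Real.pi) * ∑' q : ℕ+ × ℕ+ × ℕ+ × ℕ+, ∫ u in Ioi (0 : ℝ),
        h (√u - L) * quadTerm ψ₁ ψ₂ (√u * G) q := by
    rw [← tsum_mul_left]
    refine tsum_congr fun q => ?_
    rw [← integral_const_mul, ← integral_const_mul]
    refine setIntegral_congr_fun measurableSet_Ioi fun u hu => ?_
    have hu0 : 0 < √u := Real.sqrt_pos.2 hu
    simp only [quadTerm, Real.sqrt_mul (show (0 : ℝ) ≤ 2 * Real.pi by positivity)]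
    rw [mul_div_mul_right _ _ hu0.ne']
    ring
  have e3 : (∫ u in Ioi (0 : ℝ), ∑' q, h (√u - L) * quadTerm ψ₁ ψ₂ (√u * G) q) =
      ∫ u in Ioi (0 : ℝ), h (√u - L) * diagKer ψ₁ ψ₂ (√u * G) := by
    refine setIntegral_congr_fun measurableSet_Ioi fun u hu => ?_
    simp only [tsum_mul_left, tsum_quadTerm h₁ h₂ (mul_pos (Real.sqrt_pos.2 hu) hG)]
  have e4 : (∫ x in Ioi (0 : ℝ), 2 * x * (h (x - L) * diagKer ψ₁ ψ₂ (x * G))) =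
      ∫ v in Ioi (0 : ℝ), 2 * (v + L) * (h v * diagKer ψ₁ ψ₂ ((v + L) * G)) := by
    rw [setIntegral_eq_integral_of_forall_compl_eq_zero,
      setIntegral_eq_integral_of_forall_compl_eq_zero,
      ← integral_add_right_eq_self _ L]
    · simp only [add_sub_cancel_right]
    · intro v hv
      rw [hz v (not_lt.1 hv)]
      ring
    · intro x hx
      have : x ≤ 0 := not_lt.1 hx
      rw [hz (x - L) (by linarith)]
      ring
  unfold diagTerm
  rw [← hGdef, ← hL, e2, e1, e3, integral_comp_sqrt_Ioi (fun x => h (x - L) *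
    diagKer ψ₁ ψ₂ (x * G)), e4]
  have e5 : (∫ v in Ioi (0 : ℝ), 2 * (v + L) * (h v * diagKer ψ₁ ψ₂ ((v + L) * G))) =
      2 / G * ∫ v in Ioi (0 : ℝ), h v * ((K + v * G) * diagKer ψ₁ ψ₂ (K + v * G)) := by
    rw [← integral_const_mul]
    refine setIntegral_congr_fun measurableSet_Ioi fun v _ => ?_
    have : (v + L) * G = K + v * G := by
      rw [hL]; field_simp; ring
    simp only [← this]
    field_simp
  rw [e5]
  field_simp
  ring

end

section
open Filter Topology Asymptotics

variable {h ψ₁ ψ₂ : ℝ → ℝ}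

lemma abs_sqrt_mul_log_sub_le (A B : ℝ) {b K X : ℝ} (hK : 1 ≤ K) (hKX : K ≤ X)
    (hXb : X ≤ (1 + b) * K) :
    |√X * (A * Real.log X + B) - √K * (A * Real.log K + B)| ≤
      (X - K) / √K * (|A| * Real.log K + |A| * (b + 1) + |B|) := by
  have hK0 : 0 < K := by linarith
  have hX0 : 0 < X := by linarith
  have hsK : 0 < √K := Real.sqrt_pos.2 hK0
  have hlK : 0 ≤ Real.log K := Real.log_nonneg hK
  have hd : 0 ≤ X - K := by linarith
  have hq : √K ^ 2 = K := Real.sq_sqrt hK0.le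
  have hq' : √X ^ 2 = X := Real.sq_sqrt hX0.le
  have hsKX : √K ≤ √X := Real.sqrt_le_sqrt hKX
  have e1 : √X - √K ≤ (X - K) / √K := by
    rw [le_div_iff₀ hsK]
    nlinarith
  have e2 : Real.log X - Real.log K ≤ (X - K) / K := by
    rw [← Real.log_div hX0.ne' hK0.ne', sub_div, div_self hK0.ne']
    exact Real.log_le_sub_one_of_pos (by positivity)
  have e3 : (X - K) / K ≤ b := by
    rw [div_le_iff₀ hK0]; linarith
  have e4 : Real.log K ≤ Real.log X := Real.log_le_log hK0 hKX
  have e5 : √K * ((X - K) / K) = (X - K) / √K := by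
    nth_rewrite 3 [← hq]
    field_simp
  have e6 : √X * (A * Real.log X + B) - √K * (A * Real.log K + B) =
      (√X - √K) * (A * Real.log X + B) + √K * (A * (Real.log X - Real.log K)) := by ring
  rw [e6]
  refine (abs_add_le _ _).trans ?_
  rw [abs_mul, abs_mul, abs_mul A, abs_of_nonneg (sub_nonneg.2 hsKX), abs_of_pos hsK,
    abs_of_nonneg (sub_nonneg.2 e4)]
  have e7 : |A * Real.log X + B| ≤ |A| * (Real.log K + b) + |B| := by
    refine (abs_add_le _ _).trans ?_
    rw [abs_mul, abs_of_nonneg (hlK.trans e4)]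
    gcongr
    linarith
  calc _ ≤ (X - K) / √K * (|A| * (Real.log K + b) + |B|) + √K * (|A| * ((X - K) / K)) := by
        gcongr
    _ = (X - K) / √K * (|A| * (Real.log K + b) + |B|) + |A| * (√K * ((X - K) / K)) := by ring
    _ = _ := by rw [e5]; ring

lemma exists_mul_diagKer_sub_le (h₁ : IsCutoff ψ₁) (h₂ : IsCutoff ψ₂) {b ε : ℝ} (hb : 0 ≤ b)
    (hε : 0 < ε) : ∃ C, 0 ≤ C ∧ ∀ K G v : ℝ, 40 ≤ K → K ^ (3 / 4 : ℝ) ≤ G → G ≤ K →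
      0 ≤ v → v ≤ b →
      |(K + v * G) * diagKer ψ₁ ψ₂ (K + v * G) - √K *
        (√Real.pi / 2 * (logMass ψ₁ * logMass ψ₂) * Real.log K +
        √Real.pi * ((Real.eulerMascheroniConstant / 2 - Real.log (4 * Real.pi)) *
          (logMass ψ₁ * logMass ψ₂) + regMass ψ₁ ψ₂))| ≤ C * (G * K ^ (-(1 : ℝ) / 2 + ε)) := by
  obtain ⟨D, hD, H⟩ := exists_diagKer_bound h₁ h₂
  set A := √Real.pi / 2 * (logMass ψ₁ * logMass ψ₂)
  set B := √Real.pi * ((Real.eulerMascheroniConstant / 2 - Real.log (4 * Real.pi)) *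
          (logMass ψ₁ * logMass ψ₂) + regMass ψ₁ ψ₂)
  refine ⟨D * (1 + b) ^ (1 / 4 : ℝ) + b * (|A| / ε + |A| * (b + 1) + |B|), by positivity,
    fun K G v hK hG hGK hv hvb => ?_⟩
  have hK0 : 0 < K := by linarith
  have hG0 : 0 < G := (Real.rpow_pos_of_pos hK0 _).trans_le hG
  set X := K + v * G with hXdef
  have hKX : K ≤ X := by rw [hXdef]; linarith [mul_nonneg hv hG0.le]
  have hvG : v * G ≤ b * G := by gcongr
  have hbG : b * G ≤ b * K := by gcongr
  have hXb : X ≤ (1 + b) * K := by rw [hXdef]; linarith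
  have hX0 : 0 < X := by linarith
  have hKε : 1 ≤ K ^ ε := Real.one_le_rpow (by linarith) hε.le
  have hhalf : K ^ (-(1 : ℝ) / 2 + ε) = 1 / √K * K ^ ε := by
    rw [Real.rpow_add hK0, Real.sqrt_eq_rpow, one_div, ← Real.rpow_neg hK0.le, neg_div]
  have b1 := H X (by nlinarith [Real.pi_lt_d2, Real.pi_pos])
  have b2 := abs_sqrt_mul_log_sub_le A B (by linarith) hKX hXb
  have c1 : |X * diagKer ψ₁ ψ₂ X - √X * (A * Real.log X + B)| ≤
      D * (1 + b) ^ (1 / 4 : ℝ) * (G * K ^ (-(1 : ℝ) / 2 + ε)) := by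
    have := mul_le_mul_of_nonneg_left b1 hX0.le
    rw [← abs_of_pos hX0, ← abs_mul, abs_of_pos hX0] at this
    have s1 : X * X ^ (-(1 / 2) : ℝ) = √X := by
      rw [Real.sqrt_eq_rpow]
      nth_rewrite 1 [← Real.rpow_one X]
      rw [← Real.rpow_add hX0]
      norm_num
    have s2 : X * X ^ (-(3 / 4) : ℝ) = X ^ (1 / 4 : ℝ) := by
      nth_rewrite 1 [← Real.rpow_one X]
      rw [← Real.rpow_add hX0]
      norm_num
    have s3 : X ^ (1 / 4 : ℝ) ≤ (1 + b) ^ (1 / 4 : ℝ) * K ^ (1 / 4 : ℝ) := by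
      rw [← Real.mul_rpow (by positivity) hK0.le]
      exact Real.rpow_le_rpow hX0.le hXb (by norm_num)
    have s4 : K ^ (1 / 4 : ℝ) ≤ G * K ^ (-(1 : ℝ) / 2 + ε) := by
      calc K ^ (1 / 4 : ℝ) = K ^ (3 / 4 : ℝ) * K ^ (-(1 : ℝ) / 2) := by
            rw [← Real.rpow_add hK0]; norm_num
        _ ≤ G * K ^ (-(1 : ℝ) / 2 + ε) := by
            gcongr
            · linarith
            · linarith
    calc _ = |X * (diagKer ψ₁ ψ₂ X - (A * Real.log X + B) * X ^ (-(1 / 2) : ℝ))| := by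
          rw [← s1]; congr 1; ring
      _ ≤ X * (D * X ^ (-(3 / 4) : ℝ)) := this
      _ = D * X ^ (1 / 4 : ℝ) := by rw [← s2]; ring
      _ ≤ D * ((1 + b) ^ (1 / 4 : ℝ) * (G * K ^ (-(1 : ℝ) / 2 + ε))) := by
          gcongr
          exact s3.trans (by gcongr)
      _ = _ := by ring
  have c2 : (X - K) / √K * (|A| * Real.log K + |A| * (b + 1) + |B|) ≤
      b * (|A| / ε + |A| * (b + 1) + |B|) * (G * K ^ (-(1 : ℝ) / 2 + ε)) := by
    have hlog := Real.log_le_rpow_div hK0.le hε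
    have t1 : |A| * Real.log K + |A| * (b + 1) + |B| ≤
        (|A| / ε + |A| * (b + 1) + |B|) * K ^ ε := by
      have u1 : |A| * Real.log K ≤ |A| / ε * K ^ ε := by
        calc _ ≤ |A| * (K ^ ε / ε) := by gcongr
          _ = _ := by ring
      have u2 : |A| * (b + 1) + |B| ≤ (|A| * (b + 1) + |B|) * K ^ ε :=
        le_mul_of_one_le_right (by positivity) hKε
      linarith
    rw [hhalf]
    calc _ ≤ b * G / √K * ((|A| / ε + |A| * (b + 1) + |B|) * K ^ ε) := by
          have hl : 0 ≤ Real.log K := Real.log_nonneg (by linarith)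
          gcongr
          rw [hXdef]; linarith
      _ = _ := by ring
  calc _ ≤ |X * diagKer ψ₁ ψ₂ X - √X * (A * Real.log X + B)| + _ := abs_sub_le _ _ _
    _ ≤ _ := by
      exact (add_le_add c1 (b2.trans c2)).trans_eq (by ring)

lemma diagMain_eq (h₁ : IsCutoff ψ₁) (h₂ : IsCutoff ψ₂) {θ K : ℝ} :
    diagMain h ψ₁ ψ₂ θ K = ((K ^ θ / 8 * ((∫ v in Ioi (0 : ℝ), h v) * (√K *
        (√Real.pi / 2 * (logMass ψ₁ * logMass ψ₂) * Real.log K +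
        √Real.pi * ((Real.eulerMascheroniConstant / 2 - Real.log (4 * Real.pi)) *
          (logMass ψ₁ * logMass ψ₂) + regMass ψ₁ ψ₂)))) : ℝ) : ℂ) := by
  have hpi := Real.pi_pos
  have hW := (regMass_aux h₁ h₂).2
  have hc : √(Real.pi / 2) * √Real.pi = √2 * Real.pi / 2 := by
    rw [Real.sqrt_div hpi.le, div_mul_eq_mul_div, Real.mul_self_sqrt hpi.le]
    have : √2 * √2 = 2 := Real.mul_self_sqrt zero_le_two
    field_simp
    linarith
  have e : K ^ θ / 8 * ((∫ v in Ioi (0 : ℝ), h v) * (√K *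
        (√Real.pi / 2 * (logMass ψ₁ * logMass ψ₂) * Real.log K +
        √Real.pi * ((Real.eulerMascheroniConstant / 2 - Real.log (4 * Real.pi)) *
          (logMass ψ₁ * logMass ψ₂) + regMass ψ₁ ψ₂)))) =
      K ^ ((1 : ℝ) / 2) * K ^ θ * (√2 * Real.pi / 16) * Ihint h *
        (Real.log K / 2 * (logMass ψ₁ * logMass ψ₂) +
          (Real.eulerMascheroniConstant / 2 - Real.log (4 * Real.pi)) *
          (logMass ψ₁ * logMass ψ₂) + regMass ψ₁ ψ₂) := by
    rw [integral_eq_Ihint, ← Real.sqrt_eq_rpow, show √2 * Real.pi / 16 =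
      (√(Real.pi / 2) * √Real.pi) / 8 by rw [hc]; ring]
    ring
  rw [e, diagMain]
  push_cast
  rw [hW, h₁.mellinT_zero, h₂.mellinT_zero]
  ring

end

/-- Diagonal main-term asymptotic: with `G = K^θ`, `3/4 < θ < 1`, the diagonal sum `D'`
equals the explicit main term up to `O(K^{2+ε} G^{-1} + K^{-1/2+ε} G²)` as `K → ∞`. -/
theorem diagonal_main_term_asymptotic (h ψ₁ ψ₂ : ℝ → ℝ)
    (hh : ContDiff ℝ (⊤ : ℕ∞) h) (hhc : HasCompactSupport h) (hhs : tsupport h ⊆ Ioi 0)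
    (h1 : ContDiff ℝ (⊤ : ℕ∞) ψ₁) (h1c : HasCompactSupport ψ₁) (h1s : tsupport ψ₁ ⊆ Ioi 0)
    (h2 : ContDiff ℝ (⊤ : ℕ∞) ψ₂) (h2c : HasCompactSupport ψ₂) (h2s : tsupport ψ₂ ⊆ Ioi 0)
    (hsym1 : ∀ y : ℝ, 0 < y → ψ₁ y = ψ₁ (1 / y))
    (hsym2 : ∀ y : ℝ, 0 < y → ψ₂ y = ψ₂ (1 / y))
    (θ : ℝ) (hθ₁ : 3 / 4 < θ) (hθ₂ : θ < 1) (ε : ℝ) (hε : 0 < ε) :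
    ∃ C K₀ : ℝ, ∀ K : ℝ, K₀ ≤ K →
      ‖((diagTerm h ψ₁ ψ₂ θ K : ℝ) : ℂ) - diagMain h ψ₁ ψ₂ θ K‖ ≤
        C * (K ^ (2 + ε) / K ^ θ + K ^ (-(1 : ℝ) / 2 + ε) * (K ^ θ) ^ 2) := by
  have h₁ : IsCutoff ψ₁ := ⟨h1, h1c, h1s, hsym1⟩
  have h₂ : IsCutoff ψ₂ := ⟨h2, h2c, h2s, hsym2⟩
  obtain ⟨a, b, ha, hab, hs⟩ := exists_support_bounds hhc hhs
  obtain ⟨C, hC, H⟩ := exists_mul_diagKer_sub_le h₁ h₂ (b := b) (by linarith) hε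
  have hhi : Integrable h := hh.continuous.integrable_of_hasCompactSupport hhc
  refine ⟨C / 8 * ∫ v in Ioi (0 : ℝ), |h v|, 40, fun K hK => ?_⟩
  have hK0 : 0 < K := by linarith
  have hG0 : 0 < K ^ θ := Real.rpow_pos_of_pos hK0 θ
  have hG1 : K ^ (3 / 4 : ℝ) ≤ K ^ θ :=
    Real.rpow_le_rpow_of_exponent_le (by linarith) hθ₁.le
  have hG2 : K ^ θ ≤ K := by
    simpa using Real.rpow_le_rpow_of_exponent_le (show 1 ≤ K by linarith) hθ₂.le
  rw [diagMain_eq h₁ h₂, diagTerm_eq hh.continuous hhc hhs h₁ h₂ hK0, ← Complex.ofReal_sub,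
    Complex.norm_real, Real.norm_eq_abs, ← mul_sub, ← integral_mul_const]
  set c := √K * (√Real.pi / 2 * (logMass ψ₁ * logMass ψ₂) * Real.log K +
        √Real.pi * ((Real.eulerMascheroniConstant / 2 - Real.log (4 * Real.pi)) *
          (logMass ψ₁ * logMass ψ₂) + regMass ψ₁ ψ₂)) with hc
  set E := C * (K ^ θ * K ^ (-(1 : ℝ) / 2 + ε)) with hE
  have hbound : ∀ v ∈ Ioi (0 : ℝ), ‖h v * ((K + v * K ^ θ) * diagKer ψ₁ ψ₂ (K + v * K ^ θ)) -
      h v * c‖ ≤ |h v| * E := by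
    intro v hv
    rw [← mul_sub, norm_mul, Real.norm_eq_abs, Real.norm_eq_abs]
    by_cases h0 : h v = 0
    · simp [h0]
    · gcongr
      exact H K (K ^ θ) v hK hG1 hG2 (le_of_lt hv) (hs v h0).2.le
  have hcont : ContinuousOn (fun v => h v * ((K + v * K ^ θ) *
      diagKer ψ₁ ψ₂ (K + v * K ^ θ)) - h v * c) (Ioi 0) := by
    have := hh.continuous
    refine ContinuousOn.sub ((this.continuousOn).mul (ContinuousOn.mul (by fun_prop) ?_))
      (by fun_prop)
    refine (continuousOn_diagKer h₁ h₂).comp (by fun_prop) fun v hv => ?_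
    have : 0 < v := hv
    exact mem_Ioi.2 (by positivity)
  have hEi : IntegrableOn (fun v => |h v| * E) (Ioi 0) := (hhi.abs.mul_const E).integrableOn
  have hdi : IntegrableOn (fun v => h v * ((K + v * K ^ θ) *
      diagKer ψ₁ ψ₂ (K + v * K ^ θ)) - h v * c) (Ioi 0) := by
    refine hEi.mono' (hcont.aestronglyMeasurable measurableSet_Ioi) ?_
    filter_upwards [ae_restrict_mem measurableSet_Ioi] with v hv using hbound v hv
  have hci : IntegrableOn (fun v => h v * c) (Ioi 0) := (hhi.mul_const c).integrableOn
  have hfi : IntegrableOn (fun v => h v * ((K + v * K ^ θ) *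
      diagKer ψ₁ ψ₂ (K + v * K ^ θ))) (Ioi 0) := by
    exact (hdi.add hci).congr (ae_of_all _ fun v => sub_add_cancel _ _)
  rw [← integral_sub hfi hci, abs_mul, abs_of_pos (by positivity)]
  have hI : |∫ v in Ioi (0 : ℝ), (h v * ((K + v * K ^ θ) *
      diagKer ψ₁ ψ₂ (K + v * K ^ θ)) - h v * c)| ≤ (∫ v in Ioi (0 : ℝ), |h v|) * E := by
    rw [← integral_mul_const, ← Real.norm_eq_abs]
    refine norm_integral_le_of_norm_le hEi ?_
    filter_upwards [ae_restrict_mem measurableSet_Ioi] with v hv using hbound v hv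
  have hJ : 0 ≤ ∫ v in Ioi (0 : ℝ), |h v| := integral_nonneg fun v => abs_nonneg _
  calc _ ≤ K ^ θ / 8 * ((∫ v in Ioi (0 : ℝ), |h v|) * E) := by gcongr
    _ = (C / 8 * ∫ v in Ioi (0 : ℝ), |h v|) * (K ^ (-(1 : ℝ) / 2 + ε) * (K ^ θ) ^ 2) := by
        rw [hE]; ring
    _ ≤ _ := by
        gcongr
        have : 0 ≤ K ^ (2 + ε) / K ^ θ := by positivity
        linarith
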